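/- arXiv:math/0309192 — 2 statements merged into one kernel-verified Lean document; each statement's English description precedes it below -/
import Mathlib

section
/- Let X be a labeled graph such that either all charges of X are zero or at least one charge is positive, let s be an admissible sign function for X and H the associated operator. Then the BKN-equation over X has a compatible symmetric solution whose length function is positive (a_v > 0 for every v ∈ V) if and only if one of the following conditions holds: (1) H has a negative real eigenvalue; (2) H is positive semidefinite and supersingular. -/
open Finset Matrix

/-- A labeled graph `X = (Γ, |B|, K)`: a finite connected graph with oriented edge set `W`
(carrying the fixed-point-free orientation-reversal involution `rev` and initial-vertex map
`ini`), positive integer weights `b` on oriented edges with `b (rev w) = b w`, and real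
charges `k` on vertices. -/
structure LabeledGraph (V W : Type) [Fintype V] [DecidableEq V] [Fintype W] [DecidableEq W] where
  rev : W → W
  rev_invol : ∀ w, rev (rev w) = w
  rev_ne : ∀ w, rev w ≠ w
  ini : W → V
  b : W → ℕ
  b_pos : ∀ w, 0 < b w
  b_symm : ∀ w, b (rev w) = b w
  k : V → ℝ
  edges_nonempty : Nonempty W
  connected : ∀ u v : V,
    Relation.ReflTransGen (fun x y => ∃ w, ini w = x ∧ ini (rev w) = y) u v

namespace LabeledGraph

variable {V W : Type} [Fintype V] [DecidableEq V] [Fintype W] [DecidableEq W]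

/-- The terminal vertex `w⁺ = (-w)⁻` of an oriented edge. -/
def ter (X : LabeledGraph V W) (w : W) : V := X.ini (X.rev w)

/-- The BKN-equation over `X`: `k_v · a_v = Σ_{w ∈ ∂v} (γ_w/|b_w|) · a_{w⁺}` for all `v`. -/
def BKN (X : LabeledGraph V W) (a : V → ℝ) (γ : W → ℝ) : Prop :=
  ∀ v : V, X.k v * a v =
    ∑ w ∈ univ.filter (fun w => X.ini w = v), γ w / (X.b w : ℝ) * a (X.ter w)

/-- Compatibility of a solution `(a,γ)`. -/
def Compatible (X : LabeledGraph V W) (a : V → ℝ) (γ : W → ℝ) : Prop :=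
  (∀ v, 0 ≤ a v) ∧ a ≠ 0 ∧ (∀ w, |γ w| ≤ 1) ∧
    (∀ w, |γ w * γ (X.rev w)| = 1 → γ (X.rev w) = γ w) ∧
    (∀ v, a v = 0 → ∀ w, X.ini w = v → γ w = 0 ∧ γ (X.rev w) = 0)

/-- The angle function is symmetric: `γ_{-w} = γ_w`. -/
def SymSol (X : LabeledGraph V W) (γ : W → ℝ) : Prop := ∀ w, γ (X.rev w) = γ w

/-- An NPC-solution: a compatible symmetric solution with positive length function and
`|γ| < 1`. -/
def NPCSolution (X : LabeledGraph V W) (a : V → ℝ) (γ : W → ℝ) : Prop :=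
  X.BKN a γ ∧ X.Compatible a γ ∧ X.SymSol γ ∧ (∀ v, 0 < a v) ∧ ∀ w, |γ w| < 1

/-- The operator `A⁺ = D⁺ − J` on `ℝ^V`. -/
noncomputable def Aplus (X : LabeledGraph V W) : Matrix V V ℝ :=
  Matrix.of fun v v' =>
    (if v = v' then |X.k v| else 0)
      - ∑ w ∈ univ.filter (fun w => X.ini w = v ∧ X.ter w = v'), (1 : ℝ) / (X.b w)

/-- The operator `A_λ = D − J_λ` on `ℝ^V` for a (symmetric `±1`-valued) function `λ` on `W`. -/
noncomputable def Aop (X : LabeledGraph V W) (lam : W → ℝ) : Matrix V V ℝ :=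
  Matrix.of fun v v' =>
    (if v = v' then X.k v else 0)
      - ∑ w ∈ univ.filter (fun w => X.ini w = v ∧ X.ter w = v'), lam w / (X.b w : ℝ)

/-- Two vertices lie in the same sign component. -/
def SameSign (X : LabeledGraph V W) : V → V → Prop :=
  Relation.ReflTransGen fun x y =>
    (∃ w, X.ini w = x ∧ X.ter w = y) ∧ 0 < X.k x * X.k y

/-- A `±1`-valued sign function `s` of type (ii): constant on sign components, alternating
along edges joining distinct sign components, and equal to `1` at some vertex of positive
charge. -/
def TypeII (X : LabeledGraph V W) (s : V → ℝ) : Prop :=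
  (∀ v, s v = 1 ∨ s v = -1) ∧
    (∀ u v, X.SameSign u v → s u = s v) ∧
    (∀ w, ¬ X.SameSign (X.ini w) (X.ter w) → s (X.ini w) = - s (X.ter w)) ∧
    (∃ v, s v = 1 ∧ 0 < X.k v)

/-- An admissible sign function: of type (ii), or identically zero when no type (ii)
function exists. -/
def Admissible (X : LabeledGraph V W) (s : V → ℝ) : Prop :=
  X.TypeII s ∨ (s = 0 ∧ ¬ ∃ s', X.TypeII s')

open scoped Classical in
/-- The operator `H = D_s − J₀` associated with an admissible sign function `s`; only
oriented edges with both endpoints in one and the same sign component contribute. -/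
noncomputable def Hop (X : LabeledGraph V W) (s : V → ℝ) : Matrix V V ℝ :=
  Matrix.of fun v v' =>
    (if v = v' then s v * X.k v else 0)
      - ∑ w ∈ univ.filter
          (fun w => X.ini w = v ∧ X.ter w = v' ∧ X.SameSign (X.ini w) (X.ter w)),
          (1 : ℝ) / (X.b w)

/-- `A` has a nonpositive real eigenvalue. -/
def HasNonposEigenvalue (A : Matrix V V ℝ) : Prop :=
  ∃ μ : ℝ, μ ≤ 0 ∧ ∃ x : V → ℝ, x ≠ 0 ∧ A.mulVec x = μ • x

/-- `A` has a negative real eigenvalue. -/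
def HasNegEigenvalue (A : Matrix V V ℝ) : Prop :=
  ∃ μ : ℝ, μ < 0 ∧ ∃ x : V → ℝ, x ≠ 0 ∧ A.mulVec x = μ • x

/-- `A` is positive semidefinite: `(Ax,x) ≥ 0` for all `x`. -/
def PosSemidef' (A : Matrix V V ℝ) : Prop := ∀ x : V → ℝ, 0 ≤ x ⬝ᵥ A.mulVec x

/-- `A` is singular: it has a nontrivial kernel. -/
def Singular (A : Matrix V V ℝ) : Prop := ∃ x : V → ℝ, x ≠ 0 ∧ A.mulVec x = 0

/-- `A` is supersingular: its kernel contains a vector with all coordinates nonzero. -/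
def Supersingular (A : Matrix V V ℝ) : Prop :=
  ∃ x : V → ℝ, (∀ v, x v ≠ 0) ∧ A.mulVec x = 0

/-- `A` is weakly singular: there is a nonzero `x` with `(Ax)_v = 0` at every vertex of the
support of `x`. -/
def WeaklySingular (A : Matrix V V ℝ) : Prop :=
  ∃ x : V → ℝ, x ≠ 0 ∧ ∀ v, x v ≠ 0 → A.mulVec x v = 0

end LabeledGraph

/-- A linear image of an open convex set missing the origin of `ℝ^V` is contained in a closed
half-space, even when the linear map is not surjective. -/
theorem exists_nonneg_functional_of_zero_notMem_image {V E : Type*} [Fintype V] [DecidableEq V]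
    [NormedAddCommGroup E] [NormedSpace ℝ E] [FiniteDimensional ℝ E]
    (L : E →ₗ[ℝ] (V → ℝ)) {U : Set E} (hne : U.Nonempty) (hopen : IsOpen U)
    (hconv : Convex ℝ U) (h0 : ∀ u ∈ U, L u ≠ 0) :
    ∃ y : V → ℝ, y ≠ 0 ∧ ∀ u ∈ U, 0 ≤ ∑ v, y v * L u v := by
  obtain ⟨f, hf0, hf⟩ : ∃ f : (V → ℝ) →ₗ[ℝ] ℝ, f ≠ 0 ∧ ∀ u ∈ U, 0 ≤ f (L u) := by
    by_cases hL : Function.Surjective L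
    · have ho : IsOpen (L '' U) := L.isOpenMap_of_finiteDimensional hL U hopen
      obtain ⟨f, hf⟩ := geometric_hahn_banach_point_open (x := 0) (hconv.linear_image L) ho
        (by rintro ⟨u, hu, h⟩; exact h0 u hu h)
      have hpos : ∀ u ∈ U, 0 < f (L u) := fun u hu => by
        simpa using hf _ (Set.mem_image_of_mem L hu)
      obtain ⟨u, hu⟩ := hne
      refine ⟨(f : (V → ℝ) →ₗ[ℝ] ℝ), fun h => ?_, fun u hu => (hpos u hu).le⟩
      have := hpos u hu
      rw [← ContinuousLinearMap.coe_coe, h] at this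
      simp at this
    · obtain ⟨f, hf0, hf⟩ := (LinearMap.range L).exists_le_ker_of_lt_top
        (lt_top_iff_ne_top.2 fun h => hL (LinearMap.range_eq_top.1 h))
      exact ⟨f, hf0, fun u _ => (LinearMap.mem_ker.1 (hf ⟨u, rfl⟩)).ge⟩
  have hrep : ∀ z : V → ℝ, f z = ∑ v, f (Pi.single v 1) * z v := fun z => by
    rw [LinearMap.pi_apply_eq_sum_univ f z]
    refine sum_congr rfl fun v _ => ?_
    rw [smul_eq_mul, mul_comm]
    congr 2
    ext j
    simp [Pi.single_apply, eq_comm]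
  refine ⟨fun v => f (Pi.single v 1), fun h => hf0 ?_, fun u hu => ?_⟩
  · ext v
    simpa using congrFun h v
  · rw [← hrep]
    exact hf u hu

theorem Real.add_mul_sqrt_le_sqrt_mul {x y x' y' p q : ℝ} (hx : 0 ≤ x) (hy : 0 ≤ y)
    (hx' : 0 ≤ x') (hy' : 0 ≤ y') (hp : 0 ≤ p) (hq : 0 ≤ q) :
    p * √(x * y) + q * √(x' * y') ≤ √((p * x + q * x') * (p * y + q * y')) := by
  apply Real.le_sqrt_of_sq_le
  rw [Real.sqrt_mul hx, Real.sqrt_mul hx']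
  obtain ⟨a, ha⟩ : ∃ a, √x = a := ⟨_, rfl⟩
  obtain ⟨b, hb⟩ : ∃ b, √y = b := ⟨_, rfl⟩
  obtain ⟨c, hc⟩ : ∃ c, √x' = c := ⟨_, rfl⟩
  obtain ⟨d, hd⟩ : ∃ d, √y' = d := ⟨_, rfl⟩
  have ea : x = a ^ 2 := by rw [← ha, Real.sq_sqrt hx]
  have eb : y = b ^ 2 := by rw [← hb, Real.sq_sqrt hy]
  have ec : x' = c ^ 2 := by rw [← hc, Real.sq_sqrt hx']
  have ed : y' = d ^ 2 := by rw [← hd, Real.sq_sqrt hy']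
  rw [ha, hb, hc, hd, ea, eb, ec, ed]
  nlinarith [mul_nonneg (mul_nonneg hp hq) (sq_nonneg (a * d - b * c))]

/-- A real symmetric matrix whose quadratic form is nonpositive at a vector without zero
coordinates has a negative eigenvalue, or is positive semidefinite and supersingular. -/
theorem Matrix.IsHermitian.hasNegEigenvalue_or_supersingular {V : Type} [Fintype V]
    [DecidableEq V] {A : Matrix V V ℝ} (hA : A.IsHermitian) {x : V → ℝ} (hx : ∀ v, x v ≠ 0)
    (hle : x ⬝ᵥ A.mulVec x ≤ 0) :
    LabeledGraph.HasNegEigenvalue A ∨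
      (LabeledGraph.PosSemidef' A ∧ LabeledGraph.Supersingular A) := by
  by_cases hpsd : A.PosSemidef
  · refine Or.inr ⟨fun z => by simpa using hpsd.dotProduct_mulVec_nonneg z, x, hx, ?_⟩
    refine (hpsd.dotProduct_mulVec_zero_iff x).1 (le_antisymm (by simpa using hle) ?_)
    exact hpsd.dotProduct_mulVec_nonneg x
  · left
    rw [hA.posSemidef_iff_eigenvalues_nonneg, Pi.le_def] at hpsd
    push Not at hpsd
    obtain ⟨i, hi⟩ := hpsd
    refine ⟨_, hi, hA.eigenvectorBasis i, fun h => ?_, hA.mulVec_eigenvectorBasis i⟩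
    apply hA.eigenvectorBasis.orthonormal.ne_zero i
    ext v
    simpa using congrFun h v

namespace LabeledGraph

variable {V W : Type} [Fintype V] [DecidableEq V] [Fintype W] [DecidableEq W]

theorem ter_rev (X : LabeledGraph V W) (w : W) : X.ter (X.rev w) = X.ini w := by
  rw [ter, X.rev_invol]

/-- Summing over oriented edges is invariant under orientation reversal. -/
theorem sum_rev (X : LabeledGraph V W) (f : W → ℝ) : ∑ w, f (X.rev w) = ∑ w, f w :=
  Equiv.sum_comp (Function.Involutive.toPerm X.rev X.rev_invol) f

theorem sum_mul_sum_ini (X : LabeledGraph V W) (y : V → ℝ) (f : W → ℝ) :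
    ∑ v, y v * ∑ w ∈ univ.filter (fun w => X.ini w = v), f w = ∑ w, y (X.ini w) * f w := by
  simp_rw [sum_filter, mul_sum]
  rw [sum_comm]
  simp

theorem one_div_b_pos (X : LabeledGraph V W) (w : W) : 0 < 1 / (X.b w : ℝ) :=
  one_div_pos.2 (Nat.cast_pos.2 (X.b_pos w))

theorem SameSign.symm {X : LabeledGraph V W} {u v : V} (h : X.SameSign u v) :
    X.SameSign v u := by
  refine Relation.ReflTransGen.mono (r := Function.swap _) (fun x y => ?_) _ _ h.swap
  rintro ⟨⟨w, rfl, rfl⟩, hk⟩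
  exact ⟨⟨X.rev w, rfl, X.ter_rev w⟩, by rwa [mul_comm]⟩

theorem sameSign_edge {X : LabeledGraph V W} (w : W)
    (h : 0 < X.k (X.ini w) * X.k (X.ter w)) : X.SameSign (X.ini w) (X.ter w) :=
  Relation.ReflTransGen.single ⟨⟨w, rfl, rfl⟩, h⟩

/-- A property that propagates along edges holds everywhere as soon as it holds somewhere. -/
theorem forall_of_edge (X : LabeledGraph V W) {p : V → Prop} {u : V} (hu : p u)
    (h : ∀ w, p (X.ini w) → p (X.ter w)) (v : V) : p v := by
  induction X.connected u v with
  | refl => exact hu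
  | tail _ hw ih =>
    obtain ⟨w, rfl, rfl⟩ := hw
    exact h w ih

open scoped Classical in
theorem mulVec_Hop (X : LabeledGraph V W) (s x : V → ℝ) (v : V) :
    (X.Hop s).mulVec x v = s v * X.k v * x v -
      ∑ w ∈ univ.filter (fun w => X.ini w = v),
        if X.SameSign (X.ini w) (X.ter w) then 1 / (X.b w : ℝ) * x (X.ter w) else 0 := by
  simp only [Matrix.mulVec, dotProduct, Hop, Matrix.of_apply, sub_mul, sum_sub_distrib, ite_mul,
    zero_mul, sum_ite_eq, mem_univ, if_true, sum_filter, sum_mul]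
  congr 1
  rw [sum_comm]
  refine sum_congr rfl fun w _ => ?_
  rw [sum_eq_single (X.ter w)]
  · by_cases h1 : X.ini w = v <;> by_cases h2 : X.SameSign (X.ini w) (X.ter w) <;> simp [h1, h2]
  · intro u _ hu
    simp [hu.symm]
  · simp

open scoped Classical in
theorem dotProduct_mulVec_Hop (X : LabeledGraph V W) (s x : V → ℝ) :
    x ⬝ᵥ (X.Hop s).mulVec x = ∑ v, s v * X.k v * x v ^ 2 -
      ∑ w, if X.SameSign (X.ini w) (X.ter w) then
        1 / (X.b w : ℝ) * (x (X.ini w) * x (X.ter w)) else 0 := by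
  simp only [dotProduct, mulVec_Hop, mul_sub, sum_sub_distrib, sum_mul_sum_ini]
  congr 1
  · exact sum_congr rfl fun v _ => by ring
  · exact sum_congr rfl fun w _ => by split_ifs <;> ring

theorem isHermitian_Hop (X : LabeledGraph V W) (s : V → ℝ) : (X.Hop s).IsHermitian := by
  classical
  ext u v
  simp only [Matrix.conjTranspose_apply, star_trivial, Hop, Matrix.of_apply]
  congr 1
  · by_cases h : u = v
    · simp [h]
    · simp [h, Ne.symm h]
  · rw [sum_filter, sum_filter, ← X.sum_rev]
    refine sum_congr rfl fun w _ => ?_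
    have hS : X.SameSign (X.ter w) (X.ini w) ↔ X.SameSign (X.ini w) (X.ter w) :=
      ⟨SameSign.symm, SameSign.symm⟩
    have hi : X.ini (X.rev w) = X.ter w := rfl
    rw [X.ter_rev, X.b_symm, hi, hS]
    refine if_congr ?_ rfl rfl
    tauto

theorem Admissible.abs_le_one {X : LabeledGraph V W} {s : V → ℝ} (hs : X.Admissible s) (v : V) :
    |s v| ≤ 1 := by
  rcases hs with h | ⟨rfl, -⟩
  · rcases h.1 v with h | h <;> simp [h]
  · simp

theorem Admissible.add_eq_zero {X : LabeledGraph V W} {s : V → ℝ} (hs : X.Admissible s) {w : W}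
    (hw : ¬ X.SameSign (X.ini w) (X.ter w)) : s (X.ini w) + s (X.ter w) = 0 := by
  rcases hs with h | ⟨rfl, -⟩
  · rw [h.2.2.1 w hw, neg_add_cancel]
  · simp

/-- The quadratic form of `H` is nonpositive at the length function of a solution. -/
theorem dotProduct_mulVec_Hop_nonpos {X : LabeledGraph V W} {s : V → ℝ} (hs : X.Admissible s)
    {a : V → ℝ} {γ : W → ℝ} (hbkn : X.BKN a γ) (hsym : X.SymSol γ) (hγ : ∀ w, |γ w| ≤ 1)
    (ha : ∀ v, 0 < a v) : a ⬝ᵥ (X.Hop s).mulVec a ≤ 0 := by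
  classical
  rw [dotProduct_mulVec_Hop, sub_nonpos]
  have h1 : ∑ v, s v * X.k v * a v ^ 2 =
      ∑ w, s (X.ini w) * a (X.ini w) * (γ w / (X.b w : ℝ) * a (X.ter w)) := by
    rw [← X.sum_mul_sum_ini (fun v => s v * a v)]
    refine sum_congr rfl fun v _ => ?_
    rw [← hbkn v]
    ring
  have h2 := X.sum_rev fun w => s (X.ini w) * a (X.ini w) * (γ w / (X.b w : ℝ) * a (X.ter w))
  have h3 : ∑ w, (s (X.ini w) * a (X.ini w) * (γ w / (X.b w : ℝ) * a (X.ter w)) +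
      s (X.ter w) * a (X.ter w) * (γ w / (X.b w : ℝ) * a (X.ini w))) ≤
      ∑ w, 2 * if X.SameSign (X.ini w) (X.ter w) then
        1 / (X.b w : ℝ) * (a (X.ini w) * a (X.ter w)) else 0 := by
    refine sum_le_sum fun w _ => ?_
    have hc : 0 ≤ 1 / (X.b w : ℝ) * (a (X.ini w) * a (X.ter w)) :=
      mul_nonneg (X.one_div_b_pos w).le (mul_pos (ha _) (ha _)).le
    have he : s (X.ini w) * a (X.ini w) * (γ w / (X.b w : ℝ) * a (X.ter w)) +
        s (X.ter w) * a (X.ter w) * (γ w / (X.b w : ℝ) * a (X.ini w)) =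
        ((s (X.ini w) + s (X.ter w)) * γ w) *
          (1 / (X.b w : ℝ) * (a (X.ini w) * a (X.ter w))) := by ring
    rw [he]
    split_ifs with h
    · refine mul_le_mul_of_nonneg_right ((le_abs_self _).trans ?_) hc
      rw [abs_mul]
      have h4 : |s (X.ini w) + s (X.ter w)| ≤ 2 := (abs_add_le _ _).trans (by
        linarith [hs.abs_le_one (X.ini w), hs.abs_le_one (X.ter w)])
      nlinarith [abs_nonneg (γ w), hγ w, abs_nonneg (s (X.ini w) + s (X.ter w))]
    · simp [hs.add_eq_zero h]
  simp only [X.ter_rev, X.b_symm, hsym _] at h2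
  have hi : ∀ w, X.ini (X.rev w) = X.ter w := fun _ => rfl
  simp only [hi] at h2
  rw [sum_add_distrib, ← mul_sum, h2] at h3
  rw [h1]
  linarith

/-- The vectors `(A, m)` encoding positive lengths `a_v = √A_v` together with angles strictly
less than one in absolute value. -/
def strictDomain (X : LabeledGraph V W) : Set ((V → ℝ) × (W → ℝ)) :=
  {p | (∀ v, 0 < p.1 v) ∧
    ∀ w, 2 * |p.2 w| < 1 / (X.b w : ℝ) * √(p.1 (X.ini w) * p.1 (X.ter w))}

theorem isOpen_strictDomain (X : LabeledGraph V W) : IsOpen X.strictDomain := by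
  simp only [strictDomain, Set.ofPred_and, Set.ofPred_forall]
  refine (isOpen_iInter_of_finite fun v => isOpen_lt (by fun_prop) (by fun_prop)).inter
    (isOpen_iInter_of_finite fun w => isOpen_lt (by fun_prop) (by fun_prop))

theorem convex_strictDomain (X : LabeledGraph V W) : Convex ℝ X.strictDomain := by
  rintro ⟨A, m⟩ ⟨hA, hm⟩ ⟨A', m'⟩ ⟨hA', hm'⟩ p q hp hq hpq
  have hc : ∀ {x y : ℝ}, 0 < x → 0 < y → 0 < p * x + q * y := fun hx hy => by
    rcases hp.eq_or_lt with rfl | hp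
    · obtain rfl : q = 1 := by linarith
      simpa using hy
    · have := mul_pos hp hx
      have := mul_nonneg hq hy.le
      linarith
  refine ⟨fun v => by simpa using hc (hA v) (hA' v), fun w => ?_⟩
  have h1 := hc (sub_pos.2 (hm w)) (sub_pos.2 (hm' w))
  have h2 := mul_le_mul_of_nonneg_left (Real.add_mul_sqrt_le_sqrt_mul (hA (X.ini w)).le
    (hA (X.ter w)).le (hA' (X.ini w)).le (hA' (X.ter w)).le hp hq) (X.one_div_b_pos w).le
  have h3 : |p * m w + q * m' w| ≤ p * |m w| + q * |m' w| := by
    refine (abs_add_le _ _).trans ?_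
    rw [abs_mul, abs_mul, abs_of_nonneg hp, abs_of_nonneg hq]
  simp only [Prod.smul_mk, Prod.mk_add_mk, Pi.add_apply, Pi.smul_apply, smul_eq_mul] at h1 ⊢
  linarith

theorem nonempty_strictDomain (X : LabeledGraph V W) : X.strictDomain.Nonempty :=
  ⟨(1, 0), by simp, fun w => by simpa using X.b_pos w⟩

/-- The defect of the BKN-equation in the variables `(A, m)`. -/
noncomputable def defect (X : LabeledGraph V W) : (V → ℝ) × (W → ℝ) →ₗ[ℝ] (V → ℝ) where
  toFun p v := X.k v * p.1 v -
    ∑ w ∈ univ.filter (fun w => X.ini w = v), (p.2 w + p.2 (X.rev w))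
  map_add' p q := by
    ext v
    simp only [Prod.fst_add, Prod.snd_add, Pi.add_apply, sum_add_distrib]
    ring
  map_smul' r p := by
    ext v
    simp only [Prod.smul_fst, Prod.smul_snd, Pi.smul_apply, smul_eq_mul, RingHom.id_apply,
      ← mul_add, ← mul_sum]
    ring

theorem compatible_of_pos {X : LabeledGraph V W} {a : V → ℝ} {γ : W → ℝ} (ha : ∀ v, 0 < a v)
    (hγ : ∀ w, |γ w| ≤ 1) (hsym : X.SymSol γ) : X.Compatible a γ := by
  refine ⟨fun v => (ha v).le, fun h => ?_, hγ, fun w _ => hsym w, fun v hv => ?_⟩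
  · obtain ⟨w⟩ := X.edges_nonempty
    simpa [h] using ha (X.ini w)
  · exact absurd hv (ha v).ne'

theorem exists_solution_of_defect_eq_zero {X : LabeledGraph V W} {p : (V → ℝ) × (W → ℝ)}
    (hp : p ∈ X.strictDomain) (h0 : X.defect p = 0) :
    ∃ (a : V → ℝ) (γ : W → ℝ), X.BKN a γ ∧ X.Compatible a γ ∧ X.SymSol γ ∧ ∀ v, 0 < a v := by
  obtain ⟨A, m⟩ := p
  obtain ⟨hA, hm⟩ := hp
  dsimp only at hA hm
  have ha : ∀ v, 0 < √(A v) := fun v => Real.sqrt_pos.2 (hA v)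
  have hb : ∀ w, 0 < (X.b w : ℝ) := fun w => Nat.cast_pos.2 (X.b_pos w)
  have hi : ∀ w, X.ini (X.rev w) = X.ter w := fun _ => rfl
  have hsym : X.SymSol fun w =>
      (m w + m (X.rev w)) * X.b w / (√(A (X.ini w)) * √(A (X.ter w))) := fun w => by
    simp only [X.ter_rev, X.rev_invol, X.b_symm, hi]
    rw [add_comm, mul_comm √(A (X.ter w))]
  refine ⟨fun v => √(A v), _, fun v => ?_, compatible_of_pos ha (fun w => ?_) hsym, hsym, ha⟩
  · have hd : X.k v * A v = ∑ w ∈ univ.filter (fun w => X.ini w = v), (m w + m (X.rev w)) :=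
      sub_eq_zero.1 (congrFun h0 v)
    have : X.k v * √(A v) = (X.k v * A v) / √(A v) := by
      rw [mul_div_assoc, Real.div_sqrt]
    rw [this, hd, sum_div]
    refine sum_congr rfl fun w hw => ?_
    obtain rfl := (mem_filter.1 hw).2
    have := (ha (X.ini w)).ne'
    have := (ha (X.ter w)).ne'
    have := (hb w).ne'
    field_simp
  · have h1 := hm w
    have h2 := hm (X.rev w)
    rw [X.ter_rev, X.b_symm, hi, mul_comm (A (X.ter w))] at h2
    rw [Real.sqrt_mul (hA _).le] at h1 h2
    have hpos := mul_pos (ha (X.ini w)) (ha (X.ter w))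
    rw [abs_div, abs_mul, abs_of_pos (hb w), abs_of_pos hpos, div_le_one hpos]
    have h3 := abs_add_le (m w) (m (X.rev w))
    have h4 : |m w + m (X.rev w)| ≤ 1 / (X.b w : ℝ) * (√(A (X.ini w)) * √(A (X.ter w))) := by
      linarith
    rw [one_div, inv_mul_eq_div, le_div_iff₀ (hb w)] at h4
    exact h4

/-- `y` certifies that the BKN-equation has no positive solution with `|γ| < 1`. -/
def IsObstruction (X : LabeledGraph V W) (y : V → ℝ) : Prop :=
  y ≠ 0 ∧ ∀ a : V → ℝ, (∀ v, 0 < a v) →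
    ∑ w, 1 / (X.b w : ℝ) / 2 * |y (X.ini w) + y (X.ter w)| * (a (X.ini w) * a (X.ter w)) ≤
      ∑ v, y v * X.k v * a v ^ 2

theorem exists_isObstruction {X : LabeledGraph V W}
    (hno : ¬ ∃ (a : V → ℝ) (γ : W → ℝ), X.BKN a γ ∧ X.Compatible a γ ∧ X.SymSol γ ∧
      ∀ v, 0 < a v) : ∃ y, X.IsObstruction y := by
  obtain ⟨y, hy0, hy⟩ := exists_nonneg_functional_of_zero_notMem_image X.defect
    X.nonempty_strictDomain X.isOpen_strictDomain X.convex_strictDomain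
    fun u hu h => hno (exists_solution_of_defect_eq_zero hu h)
  refine ⟨y, hy0, fun a ha => ?_⟩
  set S := ∑ w, 1 / (X.b w : ℝ) / 2 * |y (X.ini w) + y (X.ter w)| * (a (X.ini w) * a (X.ter w))
    with hS
  have key : ∀ t : ℝ, 0 < t → t < 1 → t * S ≤ ∑ v, y v * X.k v * a v ^ 2 := by
    intro t ht0 ht1
    let m : W → ℝ := fun w => t * (1 / (X.b w : ℝ) / 2 *
      (SignType.sign (y (X.ini w) + y (X.ter w)) : ℝ) * (a (X.ini w) * a (X.ter w)))
    have hmem : ((fun v => a v ^ 2, m) : (V → ℝ) × (W → ℝ)) ∈ X.strictDomain := by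
      refine ⟨fun v => pow_pos (ha v) 2, fun w => ?_⟩
      have hpos := mul_pos (X.one_div_b_pos w) (mul_pos (ha (X.ini w)) (ha (X.ter w)))
      have hsg : |(SignType.sign (y (X.ini w) + y (X.ter w)) : ℝ)| ≤ 1 := by
        rcases SignType.sign (y (X.ini w) + y (X.ter w)) with _ | _ | _ <;> simp
      dsimp only
      rw [← mul_pow, Real.sqrt_sq (mul_pos (ha _) (ha _)).le]
      have : m w = t * ((1 / (X.b w : ℝ) * (a (X.ini w) * a (X.ter w))) / 2 *
        (SignType.sign (y (X.ini w) + y (X.ter w)) : ℝ)) := by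
        simp only [m]; ring
      rw [this, abs_mul, abs_mul, abs_of_pos ht0, abs_of_pos (half_pos hpos)]
      have h1 := mul_le_mul_of_nonneg_left hsg hpos.le
      nlinarith
    have h := hy _ hmem
    simp only [defect, LinearMap.coe_mk, AddHom.coe_mk, mul_sub, sum_sub_distrib,
      sum_mul_sum_ini, mul_add, sum_add_distrib] at h
    have h2 := X.sum_rev fun w => y (X.ini w) * m (X.rev w)
    have hi : ∀ w, X.ini (X.rev w) = X.ter w := fun _ => rfl
    simp only [X.rev_invol, hi] at h2
    have h3 : t * S = ∑ w, y (X.ini w) * m w + ∑ w, y (X.ter w) * m w := by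
      rw [hS, mul_sum, ← sum_add_distrib]
      refine sum_congr rfl fun w _ => ?_
      rw [← self_mul_sign (y (X.ini w) + y (X.ter w))]
      simp only [m]
      ring
    have h4 : ∑ v, y v * X.k v * a v ^ 2 = ∑ v, y v * (X.k v * a v ^ 2) :=
      sum_congr rfl fun v _ => by ring
    rw [h3, h4, h2]
    linarith
  have hlim : Filter.Tendsto (fun t : ℝ => t * S) (nhdsWithin 1 (Set.Iio 1)) (nhds (1 * S)) :=
    ((continuous_id.mul continuous_const).tendsto 1).mono_left nhdsWithin_le_nhds
  rw [one_mul] at hlim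
  refine le_of_tendsto hlim ?_
  filter_upwards [Ioo_mem_nhdsLT (zero_lt_one' ℝ)] with t ht using key t ht.1 ht.2

namespace IsObstruction

variable {X : LabeledGraph V W} {y : V → ℝ}

theorem le_of_nonneg (hy : X.IsObstruction y) {a : V → ℝ} (ha : ∀ v, 0 ≤ a v) :
    ∑ w, 1 / (X.b w : ℝ) / 2 * |y (X.ini w) + y (X.ter w)| * (a (X.ini w) * a (X.ter w)) ≤
      ∑ v, y v * X.k v * a v ^ 2 := by
  have h1 : Filter.Tendsto (fun t : ℝ => ∑ w, 1 / (X.b w : ℝ) / 2 *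
      |y (X.ini w) + y (X.ter w)| * ((a (X.ini w) + t) * (a (X.ter w) + t)))
      (nhdsWithin 0 (Set.Ioi 0)) (nhds (∑ w, 1 / (X.b w : ℝ) / 2 *
      |y (X.ini w) + y (X.ter w)| * ((a (X.ini w) + 0) * (a (X.ter w) + 0)))) :=
    (Continuous.tendsto (by fun_prop) 0).mono_left nhdsWithin_le_nhds
  have h2 : Filter.Tendsto (fun t : ℝ => ∑ v, y v * X.k v * (a v + t) ^ 2)
      (nhdsWithin 0 (Set.Ioi 0)) (nhds (∑ v, y v * X.k v * (a v + 0) ^ 2)) :=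
    (Continuous.tendsto (by fun_prop) 0).mono_left nhdsWithin_le_nhds
  simp only [add_zero] at h1 h2
  refine le_of_tendsto_of_tendsto h1 h2 ?_
  filter_upwards [self_mem_nhdsWithin] with t ht
  exact hy.2 (fun v => a v + t) fun v => add_pos_of_nonneg_of_pos (ha v) ht

/-- Evaluating the obstruction inequality at a vector concentrated at the origin of an edge. -/
theorem edge_le (hy : X.IsObstruction y) (w : W) : ∃ M : ℝ, ∀ T : ℝ, 1 ≤ T →
    1 / (X.b w : ℝ) / 2 * |y (X.ini w) + y (X.ter w)| * T ≤
      y (X.ini w) * X.k (X.ini w) * T ^ 2 + M := by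
  refine ⟨∑ v ∈ univ.erase (X.ini w), y v * X.k v, fun T hT => ?_⟩
  have hT0 : 0 < T := by linarith
  let a : V → ℝ := fun v => if v = X.ini w then T else 1
  have ha1 : ∀ v, 1 ≤ a v := fun v => by
    simp only [a]; split_ifs <;> linarith
  have h := hy.2 a fun v => by linarith [ha1 v]
  have h1 : ∑ v, y v * X.k v * a v ^ 2 =
      y (X.ini w) * X.k (X.ini w) * T ^ 2 + ∑ v ∈ univ.erase (X.ini w), y v * X.k v := by
    rw [← add_sum_erase _ _ (mem_univ (X.ini w))]
    congr 1
    · simp [a]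
    · refine sum_congr rfl fun v hv => ?_
      simp [a, (mem_erase.1 hv).1]
  rw [← h1]
  refine le_trans ?_ h
  have hnn : ∀ w', 0 ≤ 1 / (X.b w' : ℝ) / 2 * |y (X.ini w') + y (X.ter w')| := fun w' =>
    mul_nonneg (half_pos (X.one_div_b_pos w')).le (abs_nonneg _)
  refine le_trans ?_ (single_le_sum (fun w' _ => mul_nonneg (hnn w')
    (mul_nonneg (by linarith [ha1 (X.ini w')]) (by linarith [ha1 (X.ter w')]))) (mem_univ w))
  refine mul_le_mul_of_nonneg_left ?_ (hnn w)
  have : a (X.ini w) = T := by simp [a]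
  rw [this]
  nlinarith [ha1 (X.ter w)]

theorem exists_edge_from (X : LabeledGraph V W) (v : V) : ∃ w, X.ini w = v := by
  obtain ⟨w₀⟩ := X.edges_nonempty
  exact X.forall_of_edge (p := fun v => ∃ w, X.ini w = v) ⟨w₀, rfl⟩
    (fun w _ => ⟨X.rev w, rfl⟩) v

theorem mul_charge_nonneg (hy : X.IsObstruction y) (v : V) : 0 ≤ y v * X.k v := by
  obtain ⟨w, rfl⟩ := exists_edge_from X v
  obtain ⟨M, hM⟩ := hy.edge_le w
  by_contra! hneg
  set q := y (X.ini w) * X.k (X.ini w)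
  have hT1 : 1 ≤ 1 + |M| / (-q) :=
    le_add_of_nonneg_right (div_nonneg (abs_nonneg M) (neg_pos.2 hneg).le)
  have h := hM _ hT1
  have h0 : 0 ≤ 1 / (X.b w : ℝ) / 2 * |y (X.ini w) + y (X.ter w)| * (1 + |M| / (-q)) :=
    mul_nonneg (mul_nonneg (half_pos (X.one_div_b_pos w)).le (abs_nonneg _)) (by linarith)
  have h1 : q * (1 + |M| / (-q)) = q - |M| := by
    have := hneg.ne
    field_simp
    ring
  have h2 : q * (1 + |M| / (-q)) ^ 2 ≤ q - |M| := by
    rw [sq, ← mul_assoc, h1]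
    nlinarith [abs_nonneg M]
  linarith [le_abs_self M]

theorem ter_eq_neg (hy : X.IsObstruction y) {w : W} (hw : y (X.ini w) * X.k (X.ini w) = 0) :
    y (X.ter w) = - y (X.ini w) := by
  obtain ⟨M, hM⟩ := hy.edge_le w
  by_contra hne
  have hpos : 0 < 1 / (X.b w : ℝ) / 2 * |y (X.ini w) + y (X.ter w)| :=
    mul_pos (half_pos (X.one_div_b_pos w)) (abs_pos.2 fun h => hne (by linarith))
  set c := 1 / (X.b w : ℝ) / 2 * |y (X.ini w) + y (X.ter w)|
  have h := hM (1 + |M| / c) (le_add_of_nonneg_right (by positivity))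
  rw [hw, zero_mul, zero_add, mul_add, mul_div_cancel₀ _ hpos.ne'] at h
  linarith [le_abs_self M]

theorem ne_zero (hy : X.IsObstruction y) (v : V) : y v ≠ 0 := fun h0 =>
  hy.1 <| funext <| X.forall_of_edge (p := fun v => y v = 0) h0 fun w hw => by
    rw [hy.ter_eq_neg (by rw [hw, zero_mul]), hw, neg_zero]

theorem mul_pos_of_charges (hy : X.IsObstruction y) {u v : V} (h : 0 < X.k u * X.k v) :
    0 < y u * y v := by
  have h1 := mul_nonneg (hy.mul_charge_nonneg u) (hy.mul_charge_nonneg v)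
  have h2 : y u * y v ≠ 0 := mul_ne_zero (hy.ne_zero u) (hy.ne_zero v)
  refine lt_of_le_of_ne ?_ h2.symm
  by_contra! h3
  nlinarith [mul_pos_of_neg_of_neg h3 (neg_neg_of_pos h)]

theorem mul_pos_of_sameSign (hy : X.IsObstruction y) {u v : V} (h : X.SameSign u v) :
    0 < y u * y v := by
  induction h with
  | refl => exact mul_self_pos.2 (hy.ne_zero u)
  | @tail v z _ hvz ih =>
    have h1 := mul_pos ih (hy.mul_pos_of_charges hvz.2)
    have h2 : 0 < y v ^ 2 := by have := hy.ne_zero v; positivity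
    by_contra! h3
    nlinarith

theorem mul_neg_of_not_sameSign (hy : X.IsObstruction y) {w : W}
    (h : ¬ X.SameSign (X.ini w) (X.ter w)) : y (X.ini w) * y (X.ter w) < 0 := by
  have hi := hy.ne_zero (X.ini w)
  have ht := hy.ne_zero (X.ter w)
  have hk : X.k (X.ini w) * X.k (X.ter w) ≤ 0 := not_lt.1 fun h' => h (sameSign_edge w h')
  rcases hk.eq_or_lt with hk | hk
  · have hopp : y (X.ter w) = - y (X.ini w) := by
      rcases mul_eq_zero.1 hk with hk | hk
      · exact hy.ter_eq_neg (by rw [hk, mul_zero])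
      · have := hy.ter_eq_neg (w := X.rev w) (by
          change y (X.ter w) * X.k (X.ter w) = 0
          rw [hk, mul_zero])
        rw [X.ter_rev] at this
        change y (X.ini w) = - y (X.ter w) at this
        linarith
    rw [hopp]
    have : 0 < y (X.ini w) ^ 2 := by positivity
    nlinarith
  · have h1 := mul_nonneg (hy.mul_charge_nonneg (X.ini w)) (hy.mul_charge_nonneg (X.ter w))
    refine lt_of_le_of_ne ?_ (mul_ne_zero hi ht)
    by_contra! h3
    nlinarith [mul_pos h3 (neg_pos.2 hk)]

theorem pos_of_charge_pos (hy : X.IsObstruction y) {v : V} (h : 0 < X.k v) : 0 < y v :=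
  lt_of_le_of_ne (nonneg_of_mul_nonneg_left (hy.mul_charge_nonneg v) h) (hy.ne_zero v).symm

theorem typeII (hy : X.IsObstruction y) {p : V} (hp : 0 < X.k p) :
    X.TypeII fun v => if 0 < y v then 1 else -1 := by
  refine ⟨fun v => ?_, fun u v h => ?_, fun w h => ?_, p, if_pos (hy.pos_of_charge_pos hp), hp⟩
  · dsimp only
    split_ifs <;> simp
  · have := pos_iff_pos_of_mul_pos (hy.mul_pos_of_sameSign h)
    simp only [this]
  · have h1 := hy.mul_neg_of_not_sameSign h
    dsimp only
    rcases mul_neg_iff.1 h1 with ⟨h2, h3⟩ | ⟨h2, h3⟩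
    · rw [if_pos h2, if_neg h3.not_gt, neg_neg]
    · rw [if_neg h2.not_gt, if_pos h3]

theorem sign_mul_pos (hy : X.IsObstruction y) {s : V → ℝ} (hs : X.TypeII s) (v : V) :
    0 < s v * y v := by
  obtain ⟨hs1, hs2, hs3, p, hsp, hp⟩ := hs
  refine X.forall_of_edge (p := fun v => 0 < s v * y v) (u := p) ?_ (fun w hw => ?_) v
  · rw [hsp, one_mul]
    exact hy.pos_of_charge_pos hp
  · by_cases h : X.SameSign (X.ini w) (X.ter w)
    · have h1 := hy.mul_pos_of_sameSign h
      rw [hs2 _ _ h] at hw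
      rcases hs1 (X.ter w) with h2 | h2 <;> rw [h2] at hw ⊢ <;> by_contra! h3 <;> nlinarith
    · have h1 := hy.mul_neg_of_not_sameSign h
      rw [hs3 w h] at hw
      rcases hs1 (X.ter w) with h2 | h2 <;> rw [h2] at hw ⊢ <;> by_contra! h3 <;> nlinarith

/-- An obstruction forces the quadratic form of `H` to be nonnegative. -/
theorem posSemidef_Hop (hy : X.IsObstruction y) {s : V → ℝ} (hs : X.TypeII s) :
    PosSemidef' (X.Hop s) := by
  classical
  intro x
  have hr : ∀ v, 0 < √|y v| := fun v => Real.sqrt_pos.2 (abs_pos.2 (hy.ne_zero v))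
  have hsq : ∀ v, √|y v| ^ 2 = |y v| := fun v => Real.sq_sqrt (abs_nonneg _)
  have hsy : ∀ v, y v = s v * |y v| := fun v => by
    have h := hy.sign_mul_pos hs v
    rcases hs.1 v with h1 | h1 <;> rw [h1] at h ⊢
    · rw [abs_of_pos (by linarith), one_mul]
    · rw [abs_of_neg (by linarith)]; ring
  have h := hy.le_of_nonneg (a := fun v => |x v| / √|y v|) fun v => by positivity
  have h1 : ∑ v, y v * X.k v * (|x v| / √|y v|) ^ 2 = ∑ v, s v * X.k v * x v ^ 2 := by
    refine sum_congr rfl fun v _ => ?_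
    have hne := (abs_pos.2 (hy.ne_zero v)).ne'
    rw [div_pow, hsq, sq_abs]
    nth_rewrite 1 [hsy v]
    field_simp
  rw [dotProduct_mulVec_Hop, sub_nonneg]
  refine le_trans (sum_le_sum fun w _ => ?_) (h.trans_eq h1)
  have hc := X.one_div_b_pos w
  split_ifs with hw
  · have h2 := hy.mul_pos_of_sameSign hw
    have h3 : |y (X.ini w) + y (X.ter w)| = |y (X.ini w)| + |y (X.ter w)| := by
      rw [abs_add_eq_add_abs_iff]
      rcases mul_pos_iff.1 h2 with h | h
      · exact Or.inl ⟨h.1.le, h.2.le⟩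
      · exact Or.inr ⟨h.1.le, h.2.le⟩
    have h4 : 2 * (√|y (X.ini w)| * √|y (X.ter w)|) ≤ |y (X.ini w) + y (X.ter w)| := by
      rw [h3]
      nlinarith [sq_nonneg (√|y (X.ini w)| - √|y (X.ter w)|), hsq (X.ini w), hsq (X.ter w)]
    have h5 : x (X.ini w) * x (X.ter w) ≤ |x (X.ini w)| * |x (X.ter w)| := by
      rw [← abs_mul]
      exact le_abs_self _
    calc 1 / (X.b w : ℝ) * (x (X.ini w) * x (X.ter w))
        ≤ 1 / (X.b w : ℝ) * (|x (X.ini w)| * |x (X.ter w)|) := by gcongr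
      _ = 1 / (X.b w : ℝ) / 2 * (2 * (√|y (X.ini w)| * √|y (X.ter w)|)) *
          (|x (X.ini w)| / √|y (X.ini w)| * (|x (X.ter w)| / √|y (X.ter w)|)) := by
        have := (hr (X.ini w)).ne'
        have := (hr (X.ter w)).ne'
        field_simp
      _ ≤ _ := by gcongr
  · positivity

end IsObstruction

theorem PosSemidef'.not_hasNegEigenvalue {n : Type} [Fintype n] {A : Matrix n n ℝ} (h : PosSemidef' A) :
    ¬ HasNegEigenvalue A := by
  rintro ⟨μ, hμ, x, hx, hAx⟩
  have h1 := h x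
  rw [hAx, dotProduct_smul, smul_eq_mul] at h1
  have h2 : 0 < x ⬝ᵥ x := by
    simpa using dotProduct_star_self_pos_iff.2 hx
  nlinarith

/-- If `H` is positive semidefinite and supersingular, a positive vector in its kernel is the
length function of a solution. -/
theorem exists_solution_of_supersingular {X : LabeledGraph V W} {s : V → ℝ} (hs : X.TypeII s)
    (hpsd : PosSemidef' (X.Hop s)) (hsing : Supersingular (X.Hop s)) :
    ∃ (a : V → ℝ) (γ : W → ℝ), X.BKN a γ ∧ X.Compatible a γ ∧ X.SymSol γ ∧ ∀ v, 0 < a v := by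
  classical
  obtain ⟨x, hx0, hx⟩ := hsing
  have hPSD : (X.Hop s).PosSemidef :=
    .of_dotProduct_mulVec_nonneg (X.isHermitian_Hop s) fun z => by simpa using hpsd z
  have hle : (fun v => |x v|) ⬝ᵥ (X.Hop s).mulVec (fun v => |x v|) ≤ x ⬝ᵥ (X.Hop s).mulVec x := by
    rw [dotProduct_mulVec_Hop, dotProduct_mulVec_Hop]
    simp only [sq_abs]
    refine sub_le_sub_left (sum_le_sum fun w _ => ?_) _
    split_ifs
    · rw [← abs_mul]
      exact mul_le_mul_of_nonneg_left (le_abs_self _) (X.one_div_b_pos w).le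
    · exact le_rfl
  rw [hx, dotProduct_zero] at hle
  have hker : (X.Hop s).mulVec (fun v => |x v|) = 0 :=
    (hPSD.dotProduct_mulVec_zero_iff _).1 (le_antisymm (by simpa using hle)
      (hPSD.dotProduct_mulVec_nonneg _))
  have hss : ∀ v, s v * s v = 1 := fun v => by rcases hs.1 v with h | h <;> simp [h]
  have hsym : X.SymSol fun w => if X.SameSign (X.ini w) (X.ter w) then s (X.ini w) else 0 := by
    intro w
    have hi : X.ini (X.rev w) = X.ter w := rfl
    dsimp only
    rw [X.ter_rev, hi]
    by_cases h : X.SameSign (X.ini w) (X.ter w)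
    · rw [if_pos h, if_pos h.symm, hs.2.1 _ _ h]
    · rw [if_neg h, if_neg fun h' => h h'.symm]
  have hpos : ∀ v, 0 < |x v| := fun v => abs_pos.2 (hx0 v)
  refine ⟨fun v => |x v|, _, fun v => ?_, compatible_of_pos hpos (fun w => ?_) hsym, hsym, hpos⟩
  · have h := congrFun hker v
    rw [mulVec_Hop, Pi.zero_apply, sub_eq_zero] at h
    calc X.k v * |x v| = s v * (s v * X.k v * |x v|) := by
          rw [← mul_assoc, ← mul_assoc, hss, one_mul]
      _ = _ := by
        rw [h, mul_sum]
        refine sum_congr rfl fun w hw => ?_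
        obtain rfl := (mem_filter.1 hw).2
        split_ifs
        · ring
        · simp
  · split_ifs
    · rcases hs.1 (X.ini w) with h | h <;> simp [h]
    · simp

end LabeledGraph

open LabeledGraph in
/-- Spectral criterion for (VF): the BKN-equation over `X` (with all charges zero or at
least one positive charge) has a compatible symmetric solution with positive length
function iff either (1) the operator `H` has a negative real eigenvalue, or (2) `H` is
positive semidefinite and supersingular. -/
theorem compatible_symmetric_positive_solution_iff_spectral
    {V W : Type} [Fintype V] [DecidableEq V] [Fintype W] [DecidableEq W]
    (X : LabeledGraph V W)
    (hcharges : (∀ v, X.k v = 0) ∨ (∃ v, 0 < X.k v))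
    (s : V → ℝ) (hs : X.Admissible s) :
    (∃ (a : V → ℝ) (γ : W → ℝ), X.BKN a γ ∧ X.Compatible a γ ∧ X.SymSol γ ∧
        ∀ v, 0 < a v) ↔
      (HasNegEigenvalue (X.Hop s) ∨
        (PosSemidef' (X.Hop s) ∧ Supersingular (X.Hop s))) := by
  constructor
  · rintro ⟨a, γ, hbkn, hcomp, hsym, ha⟩
    exact (X.isHermitian_Hop s).hasNegEigenvalue_or_supersingular (fun v => (ha v).ne')
      (dotProduct_mulVec_Hop_nonpos hs hbkn hsym hcomp.2.2.1 ha)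
  · intro h
    rcases hcharges with hk | ⟨p, hp⟩
    · have hsym : X.SymSol 0 := fun _ => rfl
      exact ⟨1, 0, fun v => by simp [hk v],
        compatible_of_pos (fun _ => one_pos) (by simp) hsym, hsym, fun _ => one_pos⟩
    · by_contra hno
      obtain ⟨y, hy⟩ := exists_isObstruction hno
      rcases hs with hs | ⟨-, hs⟩
      · rcases h with h | ⟨h1, h2⟩
        · exact (hy.posSemidef_Hop hs).not_hasNegEigenvalue h
        · exact hno (exists_solution_of_supersingular hs h1 h2)
      · exact hs ⟨_, hy.typeII hp⟩
end

section
/- Let X be a labeled graph such that either all charges of X are zero or at least one charge is positive, let s be an admissible sign function for X and H the associated operator. Then the BKN-equation over X has an NPC-solution if and only if H has a negative real eigenvalue or s ≡ 0. -/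
open Finset Matrix

/-- A symmetric real matrix whose quadratic form takes a negative value has a negative
eigenvalue. -/
theorem hasNegEigenvalue_of_dotProduct_neg {V : Type} [Fintype V] [DecidableEq V]
    {A : Matrix V V ℝ} (hA : A.IsSymm) {x : V → ℝ} (hx : x ⬝ᵥ A *ᵥ x < 0) :
    LabeledGraph.HasNegEigenvalue A := by
  have hH : A.IsHermitian := by
    rw [Matrix.IsHermitian, conjTranspose_eq_transpose_of_trivial]
    exact hA
  by_contra hneg
  have hps : A.PosSemidef := by
    rw [hH.posSemidef_iff_eigenvalues_nonneg]
    intro i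
    by_contra hi
    refine hneg ⟨hH.eigenvalues i, not_le.mp hi, hH.eigenvectorBasis i, ?_, ?_⟩
    · intro h0
      exact hH.eigenvectorBasis.orthonormal.ne_zero i (by ext j; simpa using congrFun h0 j)
    · exact hH.mulVec_eigenvectorBasis i
  have := hps.dotProduct_mulVec_nonneg x
  simp only [star_trivial] at this
  linarith

theorem dotProduct_neg_of_hasNegEigenvalue {V : Type} [Fintype V] [DecidableEq V]
    {A : Matrix V V ℝ} (hA : LabeledGraph.HasNegEigenvalue A) :
    ∃ x : V → ℝ, x ⬝ᵥ A *ᵥ x < 0 := by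
  obtain ⟨μ, hμ, x, hx, h⟩ := hA
  refine ⟨x, ?_⟩
  rw [h, dotProduct_smul, smul_eq_mul]
  refine mul_neg_of_neg_of_pos hμ (lt_of_le_of_ne ?_ (Ne.symm ?_))
  · exact Finset.sum_nonneg fun i _ => mul_self_nonneg _
  · exact fun h0 => hx (dotProduct_self_eq_zero.mp h0)

/-- A nonnegative symmetric matrix `J`, supported where the diagonal weight `d` is nonzero,
whose quadratic form somewhere exceeds that of `d`, has a nonnegative generalized eigenvector
`J a = μ d a` with `μ > 1`. -/
theorem exists_nonneg_generalized_eigenvector {V : Type} [Fintype V] [DecidableEq V]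
    {d : V → ℝ} {J : Matrix V V ℝ} (hd : ∀ i, 0 ≤ d i) (hJ : ∀ i j, 0 ≤ J i j)
    (hsymm : J.IsSymm) (hz : ∀ i j, d i = 0 → J i j = 0) {x : V → ℝ}
    (hx : ∑ i, d i * x i ^ 2 < x ⬝ᵥ J *ᵥ x) :
    ∃ μ : ℝ, 1 < μ ∧ ∃ a : V → ℝ, (∀ i, 0 ≤ a i) ∧ (∃ i, 0 < d i ∧ 0 < a i) ∧
      ∀ i, μ * (d i * a i) = (J *ᵥ a) i := by
  set q : (V → ℝ) → ℝ := fun z => z ⬝ᵥ J *ᵥ z with hq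
  set D : (V → ℝ) → ℝ := fun z => ∑ i, d i * z i ^ 2 with hD
  have q_eq (z : V → ℝ) : q z = ∑ i, ∑ j, z i * J i j * z j := by
    simp only [hq, dotProduct, mulVec, Finset.mul_sum, mul_assoc]
  have q_smul (c : ℝ) (z : V → ℝ) : q (c • z) = c ^ 2 * q z := by
    simp only [q_eq, Finset.mul_sum, Pi.smul_apply, smul_eq_mul]
    exact Finset.sum_congr rfl fun i _ => Finset.sum_congr rfl fun j _ => by ring
  have D_smul (c : ℝ) (z : V → ℝ) : D (c • z) = c ^ 2 * D z := by
    simp only [hD, Finset.mul_sum, Pi.smul_apply, smul_eq_mul]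
    exact Finset.sum_congr rfl fun i _ => by ring
  let r : (V → ℝ) → V → ℝ := fun z i => if d i = 0 then 0 else z i
  have q_r (z : V → ℝ) : q (r z) = q z := by
    simp only [q_eq]
    refine Finset.sum_congr rfl fun i _ => Finset.sum_congr rfl fun j _ => ?_
    by_cases hi : d i = 0
    · simp [hz i j hi]
    · by_cases hj : d j = 0
      · have : J i j = 0 := by rw [← hsymm.apply i j]; exact hz j i hj
        simp [this]
      · simp [r, hi, hj]
  have D_r (z : V → ℝ) : D (r z) = D z := by
    refine Finset.sum_congr rfl fun i _ => ?_
    by_cases hi : d i = 0 <;> simp [r, hi]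
  let P : Set (V → ℝ) := Metric.sphere 0 1 ∩ {y | ∀ i, d i = 0 → y i = 0}
  have hPc : IsCompact P := by
    refine (isCompact_sphere _ _).inter_right ?_
    simp only [Set.ofPred_forall]
    exact isClosed_iInter fun i => isClosed_iInter fun _ =>
      isClosed_eq (continuous_apply i) continuous_const
  have D_pos : ∀ y ∈ P, 0 < D y := by
    rintro y ⟨hy1, hy2⟩
    refine lt_of_le_of_ne (Finset.sum_nonneg fun i _ => mul_nonneg (hd i) (sq_nonneg _)) ?_
    intro h0
    have hy0 : y = 0 := by
      ext i
      by_cases hi : d i = 0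
      · exact hy2 i hi
      · have := (Finset.sum_eq_zero_iff_of_nonneg
          (fun i _ => mul_nonneg (hd i) (sq_nonneg (y i)))).mp h0.symm i (Finset.mem_univ i)
        simpa [hi] using this
    simp [hy0] at hy1
  have normalize (z : V → ℝ) (h : r z ≠ 0) :
      ∃ c : ℝ, 0 < c ∧ ∃ y ∈ P, q z = c ^ 2 * q y ∧ D z = c ^ 2 * D y := by
    have hn : ‖r z‖ ≠ 0 := norm_ne_zero_iff.mpr h
    have hsm : ‖r z‖ • (‖r z‖⁻¹ • r z) = r z := by rw [smul_smul, mul_inv_cancel₀ hn, one_smul]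
    refine ⟨‖r z‖, norm_pos_iff.mpr h, ‖r z‖⁻¹ • r z, ⟨?_, ?_⟩, ?_, ?_⟩
    · simp [norm_smul, hn]
    · intro i hi
      simp [r, hi]
    · rw [← q_smul, hsm, q_r]
    · rw [← D_smul, hsm, D_r]
  have hrx : r x ≠ 0 := by
    intro h0
    have h1 : D x < q x := hx
    rw [← D_r, ← q_r, h0] at h1
    simp [hq, hD] at h1
  obtain ⟨c, hc, y, hyP, hqy, hDy⟩ := normalize x hrx
  have hcont : ContinuousOn (fun z => q z / D z) P := by
    refine ContinuousOn.div ?_ ?_ fun z hz => (D_pos z hz).ne'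
    · have : q = fun z => ∑ i, ∑ j, z i * J i j * z j := funext q_eq
      rw [this]
      fun_prop
    · simp only [hD]
      fun_prop
  obtain ⟨m, hmP, hmax⟩ := hPc.exists_isMaxOn ⟨y, hyP⟩ hcont
  set μ := q m / D m with hμ
  have hmq : q m = μ * D m := by rw [hμ, div_mul_cancel₀ _ (D_pos m hmP).ne']
  have hle : ∀ z, q z ≤ μ * D z := by
    intro z
    by_cases h : r z = 0
    · rw [← q_r z, ← D_r z, h]
      simp [hq, hD]
    · obtain ⟨e, he, u, huP, h1, h2⟩ := normalize z h
      have : q u / D u ≤ μ := hmax huP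
      rw [div_le_iff₀ (D_pos u huP)] at this
      rw [h1, h2]
      nlinarith [sq_nonneg e]
  have hμ1 : 1 < μ := by
    have h1 := hmax hyP
    refine lt_of_lt_of_le ?_ h1
    rw [one_lt_div (D_pos y hyP)]
    have h2 : D x < q x := hx
    rw [hqy, hDy] at h2
    exact lt_of_mul_lt_mul_left h2 (sq_nonneg c)
  let a : V → ℝ := fun i => |m i|
  have hDa : D a = D m := by simp [hD, a]
  have hqa : q m ≤ q a := by
    simp only [q_eq]
    refine Finset.sum_le_sum fun i _ => Finset.sum_le_sum fun j _ => ?_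
    calc m i * J i j * m j ≤ |m i * J i j * m j| := le_abs_self _
      _ = _ := by rw [abs_mul, abs_mul, abs_of_nonneg (hJ i j)]
  let G : Matrix V V ℝ := Matrix.diagonal (fun i => μ * d i) - J
  have hGv (z : V → ℝ) (i : V) : (G *ᵥ z) i = μ * (d i * z i) - (J *ᵥ z) i := by
    simp [G, Matrix.sub_mulVec, Matrix.mulVec_diagonal, mul_assoc]
  have hGq (z : V → ℝ) : z ⬝ᵥ G *ᵥ z = μ * D z - q z := by
    simp only [hq, hD, dotProduct, hGv, Finset.mul_sum, ← Finset.sum_sub_distrib]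
    exact Finset.sum_congr rfl fun i _ => by ring
  have hGps : G.PosSemidef := by
    refine Matrix.PosSemidef.of_dotProduct_mulVec_nonneg ?_ fun z => ?_
    · have : G.IsSymm := (Matrix.isSymm_diagonal _).sub hsymm
      rw [Matrix.IsHermitian, conjTranspose_eq_transpose_of_trivial]
      exact this
    · rw [star_trivial, hGq]
      linarith [hle z]
  have hGa : G *ᵥ a = 0 := by
    rw [← hGps.dotProduct_mulVec_zero_iff, star_trivial, hGq]
    have := hle a
    rw [hDa] at this ⊢
    linarith
  refine ⟨μ, hμ1, a, fun i => abs_nonneg _, ?_, fun i => ?_⟩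
  · by_contra! hcon
    have hm0 : m = 0 := by
      ext i
      by_cases hi : d i = 0
      · exact hmP.2 i hi
      · have := hcon i (lt_of_le_of_ne (hd i) (Ne.symm hi))
        exact abs_nonpos_iff.mp this
    have := D_pos m hmP
    simp [hD, hm0] at this
  · have := congrFun hGa i
    rw [hGv, Pi.zero_apply] at this
    linarith

/-- Positive weights balancing a finite family of reals taking both signs. -/
theorem exists_pos_weights_sum_eq_zero {V : Type} [DecidableEq V] {N : Finset V} {f : V → ℝ} {u v : V} (hu : u ∈ N)
    (hv : v ∈ N) (hfu : 0 < f u) (hfv : f v < 0) :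
    ∃ α : V → ℝ, (∀ i, 0 < α i) ∧ ∑ i ∈ N, f i * α i = 0 := by
  have key (p : V) (hp : p ∈ N) (hfp : f p ≠ 0) (hT : 0 ≤ -(∑ i ∈ N, f i) / f p) :
      ∃ α : V → ℝ, (∀ i, 0 < α i) ∧ ∑ i ∈ N, f i * α i = 0 := by
    refine ⟨fun i => 1 + if i = p then -(∑ i ∈ N, f i) / f p else 0, fun i => ?_, ?_⟩
    · dsimp only
      split_ifs <;> linarith
    · simp only [mul_add, mul_one, Finset.sum_add_distrib, mul_ite, mul_zero,
        Finset.sum_ite_eq', hp, if_true]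
      field_simp
      ring
  rcases le_total 0 (∑ i ∈ N, f i) with h | h
  · exact key v hv hfv.ne (div_nonneg_of_nonpos (by linarith) hfv.le)
  · exact key u hu hfu.ne' (div_nonneg (by linarith) hfu.le)

namespace LabeledGraph

variable {V W : Type} [Fintype V] [DecidableEq V] [Fintype W] [DecidableEq W]

theorem ini_rev (X : LabeledGraph V W) (w : W) : X.ini (X.rev w) = X.ter w := rfl

theorem b_cast_pos (X : LabeledGraph V W) (w : W) : (0 : ℝ) < X.b w := by
  exact_mod_cast X.b_pos w

/-- The sum of an edge function over the oriented edges starting at each vertex. -/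
def net (X : LabeledGraph V W) : (W → ℝ) →ₗ[ℝ] (V → ℝ) where
  toFun x v := ∑ w ∈ univ.filter (fun w => X.ini w = v), x w
  map_add' x y := by ext v; simp [Finset.sum_add_distrib]
  map_smul' c x := by ext v; simp [Finset.mul_sum]

theorem net_apply (X : LabeledGraph V W) (x : W → ℝ) (v : V) :
    X.net x v = ∑ w ∈ univ.filter (fun w => X.ini w = v), x w := rfl

theorem net_single (X : LabeledGraph V W) (w : W) :
    X.net (Pi.single w 1) = Pi.single (X.ini w) 1 := by
  ext v
  rw [net_apply, Finset.sum_filter]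
  simp only [Pi.single_apply, eq_comm (a := v)]
  rw [Finset.sum_eq_single w]
  · simp
  · intro u _ hu
    simp [hu]
  · simp

/-- Symmetric edge functions vanishing outside a set of edges. -/
def flows (X : LabeledGraph V W) (M : Set W) : Submodule ℝ (W → ℝ) where
  carrier := {x | (∀ w, x (X.rev w) = x w) ∧ ∀ w, w ∉ M → x w = 0}
  add_mem' := by
    rintro x y ⟨hx, hx'⟩ ⟨hy, hy'⟩
    exact ⟨fun w => by simp [hx w, hy w], fun w hw => by simp [hx' w hw, hy' w hw]⟩
  zero_mem' := ⟨fun _ => rfl, fun _ _ => rfl⟩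
  smul_mem' := by
    rintro c x ⟨hx, hx'⟩
    exact ⟨fun w => by simp [hx w], fun w hw => by simp [hx' w hw]⟩

theorem mem_flows {X : LabeledGraph V W} {M : Set W} {x : W → ℝ} :
    x ∈ X.flows M ↔ (∀ w, x (X.rev w) = x w) ∧ ∀ w, w ∉ M → x w = 0 := Iff.rfl

theorem flows_mono (X : LabeledGraph V W) {M N : Set W} (h : M ⊆ N) :
    X.flows M ≤ X.flows N :=
  fun _ hx => ⟨hx.1, fun w hw => hx.2 w fun hm => hw (h hm)⟩

/-- A single edge, with both orientations, carries a flow with excess one at each end. -/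
theorem exists_flow_edge (X : LabeledGraph V W) {M : Set W} {w : W} (hw : w ∈ M)
    (hw' : X.rev w ∈ M) :
    ∃ φ ∈ X.flows M, X.net φ = Pi.single (X.ini w) 1 + Pi.single (X.ter w) 1 := by
  refine ⟨Pi.single w 1 + Pi.single (X.rev w) 1, ⟨fun u => ?_, fun u hu => ?_⟩, ?_⟩
  · have h1 : X.rev u = w ↔ u = X.rev w :=
      ⟨fun h => by rw [← h, X.rev_invol], fun h => by rw [h, X.rev_invol]⟩
    have h2 : X.rev u = X.rev w ↔ u = w :=
      ⟨fun h => by rw [← X.rev_invol u, h, X.rev_invol], fun h => by rw [h]⟩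
    simp only [Pi.add_apply, Pi.single_apply, h1, h2]
    ring
  · have h1 : u ≠ w := fun h => hu (h ▸ hw)
    have h2 : u ≠ X.rev w := fun h => hu (h ▸ hw')
    simp [h1, h2]
  · rw [map_add, net_single, net_single, ini_rev]

/-- Along a path of allowed edges, excess can be transported up to sign. -/
theorem exists_flow_path (X : LabeledGraph V W) {M : Set W} (hM : ∀ w ∈ M, X.rev w ∈ M) {q p : V}
    (h : Relation.ReflTransGen (fun x y => ∃ w ∈ M, X.ini w = x ∧ X.ter w = y) q p) :
    ∃ φ ∈ X.flows M, ∃ c : ℝ, (c = 1 ∨ c = -1) ∧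
      X.net φ = Pi.single p 1 - c • Pi.single q 1 := by
  induction h with
  | refl => exact ⟨0, Submodule.zero_mem _, 1, Or.inl rfl, by simp⟩
  | tail _ hstep ih =>
    obtain ⟨φ, hφ, c, hc, hnet⟩ := ih
    obtain ⟨w, hw, rfl, rfl⟩ := hstep
    obtain ⟨ψ, hψ, hψn⟩ := X.exists_flow_edge hw (hM w hw)
    refine ⟨ψ - φ, Submodule.sub_mem _ hψ hφ, -c, ?_, ?_⟩
    · rcases hc with rfl | rfl <;> simp
    · rw [map_sub, hnet, hψn, neg_smul]
      abel

/-- Edges with both ends in `S`. -/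
def inner (X : LabeledGraph V W) (S : Set V) : Set W := {w | X.ini w ∈ S ∧ X.ter w ∈ S}

/-- A solution with positive lengths and strict angle bounds on the part of the graph spanned by
`S`, expressed through the products `x w = γ w * a (ini w) * a (ter w) / b w`, in which any
excess can be moved to a charged vertex `v₀`. -/
structure PartialSol (X : LabeledGraph V W) (S : Set V) (v₀ : V) (a : V → ℝ) (x : W → ℝ) :
    Prop where
  pos : ∀ v ∈ S, 0 < a v
  flow : x ∈ X.flows (X.inner S)
  bound : ∀ w ∈ X.inner S, |x w| * X.b w < a (X.ini w) * a (X.ter w)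
  eqn : ∀ v ∈ S, X.net x v = X.k v * a v ^ 2
  root_mem : v₀ ∈ S
  root_ne : X.k v₀ ≠ 0
  reach : ∀ p ∈ S, ∃ φ ∈ X.flows (X.inner S), ∃ c : ℝ,
    X.net φ = Pi.single p 1 - c • Pi.single v₀ 1

theorem net_eq_zero_of_notMem {X : LabeledGraph V W} {S : Set V} {x : W → ℝ}
    (hx : x ∈ X.flows (X.inner S)) {v : V} (hv : v ∉ S) : X.net x v = 0 := by
  rw [net_apply]
  refine Finset.sum_eq_zero fun w hw => hx.2 w fun hm => hv ?_
  rw [← (Finset.mem_filter.mp hw).2]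
  exact hm.1

open Filter Topology in
theorem PartialSol.extend {X : LabeledGraph V W} {S : Set V} {v₀ : V} {a : V → ℝ} {x : W → ℝ}
    (h : X.PartialSol S v₀ a x) {w₀ : W} (hu : X.ini w₀ ∉ S) (hp : X.ter w₀ ∈ S) :
    ∃ a' x', X.PartialSol (insert (X.ini w₀) S) v₀ a' x' := by
  set u := X.ini w₀ with hudef
  have hsub : X.inner S ⊆ X.inner (insert u S) := fun w hw =>
    ⟨Set.mem_insert_of_mem _ hw.1, Set.mem_insert_of_mem _ hw.2⟩
  have huv : u ≠ v₀ := fun e => hu (e ▸ h.root_mem)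
  obtain ⟨φ, hφ, c, hφn⟩ := h.reach _ hp
  obtain ⟨ψ, hψ, hψn⟩ := X.exists_flow_edge (M := {w₀, X.rev w₀}) (w := w₀) (by simp) (by simp)
  have hedge : ({w₀, X.rev w₀} : Set W) ⊆ X.inner (insert u S) := by
    rintro w (rfl | rfl)
    · exact ⟨Set.mem_insert _ _, Set.mem_insert_of_mem _ hp⟩
    · exact ⟨Set.mem_insert_of_mem _ hp, by rw [ter_rev]; exact Set.mem_insert _ _⟩
  set F := ψ - φ with hF
  have hFmem : F ∈ X.flows (X.inner (insert u S)) :=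
    Submodule.sub_mem _ (X.flows_mono hedge hψ) (X.flows_mono hsub hφ)
  have hFn : X.net F = Pi.single u 1 + c • Pi.single v₀ 1 := by
    rw [hF, map_sub, hψn, hφn]
    abel
  have hF_loop : ∀ w, X.ini w = u → X.ter w = u → F w = 0 := by
    intro w h1 h2
    have e1 : φ w = 0 := hφ.2 w fun hm => hu (h1 ▸ hm.1)
    have e2 : ψ w = 0 := by
      refine hψ.2 w ?_
      rintro (rfl | rfl)
      · exact hu (h2 ▸ hp)
      · exact hu (h1 ▸ hp)
    simp [hF, e1, e2]
  let a' : ℝ → V → ℝ := fun δ v => if v = u then δ else if v = v₀ then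
    √(a v₀ ^ 2 + c * X.k u / X.k v₀ * δ ^ 2) else a v
  let x' : ℝ → W → ℝ := fun δ => x + (X.k u * δ ^ 2) • F
  have ha'u (δ : ℝ) : a' δ u = δ := by simp [a']
  have ha'c : ∀ v ∈ S, Tendsto (fun δ => a' δ v) (𝓝[>] 0) (𝓝 (a v)) := by
    intro v hv
    have hvu : v ≠ u := fun e => hu (e ▸ hv)
    refine Tendsto.mono_left ?_ nhdsWithin_le_nhds
    by_cases hv0 : v = v₀
    · subst hv0
      have : Continuous fun δ : ℝ => √(a v ^ 2 + c * X.k u / X.k v * δ ^ 2) := by fun_prop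
      have := this.tendsto 0
      simpa [a', hvu, Real.sqrt_sq (h.pos v hv).le] using this
    · simp [a', hvu, hv0]
  have hx'c (w : W) : Tendsto (fun δ => |x' δ w| * X.b w) (𝓝[>] 0) (𝓝 (|x w| * X.b w)) := by
    refine Tendsto.mono_left ?_ nhdsWithin_le_nhds
    have : Continuous fun δ : ℝ => |x w + X.k u * δ ^ 2 * F w| * X.b w := by fun_prop
    simpa [x'] using this.tendsto 0
  have ev_delta : ∀ᶠ δ : ℝ in 𝓝[>] 0, 0 < δ := self_mem_nhdsWithin
  have ev_pos : ∀ᶠ δ in 𝓝[>] (0 : ℝ), ∀ v, v ∈ S → 0 < a' δ v :=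
    eventually_all.mpr fun v => by
      by_cases hv : v ∈ S
      · filter_upwards [(ha'c v hv).eventually_const_lt (h.pos v hv)] with δ hδ _ using hδ
      · simp [hv]
  have ev_rad : ∀ᶠ δ in 𝓝[>] (0 : ℝ), 0 < a v₀ ^ 2 + c * X.k u / X.k v₀ * δ ^ 2 := by
    have : Continuous fun δ : ℝ => a v₀ ^ 2 + c * X.k u / X.k v₀ * δ ^ 2 := by fun_prop
    have := (this.tendsto 0).mono_left (nhdsWithin_le_nhds (s := Set.Ioi 0))
    refine this.eventually_const_lt ?_
    have := h.pos v₀ h.root_mem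
    simp only [ne_eq, OfNat.ofNat_ne_zero, not_false_eq_true, zero_pow, mul_zero, add_zero]
    positivity
  have ev_inner : ∀ᶠ δ in 𝓝[>] (0 : ℝ), ∀ w, w ∈ X.inner S →
      |x' δ w| * X.b w < a' δ (X.ini w) * a' δ (X.ter w) :=
    eventually_all.mpr fun w => by
      by_cases hw : w ∈ X.inner S
      · filter_upwards [(hx'c w).eventually_lt ((ha'c _ hw.1).mul (ha'c _ hw.2)) (h.bound w hw)]
          with δ hδ _ using hδ
      · simp [hw]
  have ev_new : ∀ᶠ δ in 𝓝[>] (0 : ℝ), ∀ w v, v ∈ S →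
      |X.k u| * δ * |F w| * X.b w < a' δ v :=
    eventually_all.mpr fun w => eventually_all.mpr fun v => by
      by_cases hv : v ∈ S
      · have : Continuous fun δ : ℝ => |X.k u| * δ * |F w| * X.b w := by fun_prop
        have := (this.tendsto 0).mono_left (nhdsWithin_le_nhds (s := Set.Ioi 0))
        filter_upwards [this.eventually_lt (ha'c v hv) (by simpa using h.pos v hv)]
          with δ hδ _ using hδ
      · simp [hv]
  obtain ⟨δ, hδ, hpos, hrad, hinner, hnew⟩ :=
    (ev_delta.and (ev_pos.and (ev_rad.and (ev_inner.and ev_new)))).exists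
  have hx0 : ∀ w, w ∉ X.inner S → x w = 0 := h.flow.2
  have hnew' : ∀ w, w ∉ X.inner S → ∀ v ∈ S, |x' δ w| * X.b w < δ * a' δ v := by
    intro w hw v hv
    have := mul_lt_mul_of_pos_left (hnew w v hv) hδ
    have e : |x' δ w| = |X.k u| * δ ^ 2 * |F w| := by
      simp [x', hx0 w hw, abs_mul]
    rw [e]
    linarith
  refine ⟨a' δ, x' δ, ?_, ?_, ?_, ?_, Set.mem_insert_of_mem _ h.root_mem, h.root_ne, ?_⟩
  · rintro v (rfl | hv)
    · rwa [ha'u]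
    · exact hpos v hv
  · exact Submodule.add_mem _ (X.flows_mono hsub h.flow) (Submodule.smul_mem _ _ hFmem)
  · rintro w ⟨h1 | h1, h2 | h2⟩
    · have : x' δ w = 0 := by
        simp [x', hF_loop w h1 h2, hx0 w fun hm => hu (h1 ▸ hm.1)]
      rw [this, h1, h2, ha'u]
      simpa using mul_pos hδ hδ
    · rw [h1, ha'u]
      exact hnew' w (fun hm => hu (h1 ▸ hm.1)) _ h2
    · rw [h2, ha'u, mul_comm (a' δ _)]
      exact hnew' w (fun hm => hu (h2 ▸ hm.2)) _ h1
    · exact hinner w ⟨h1, h2⟩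
  · have hnet (v : V) : X.net (x' δ) v = X.net x v
        + X.k u * δ ^ 2 * ((Pi.single u 1 : V → ℝ) v + c * (Pi.single v₀ 1 : V → ℝ) v) := by
      simp [x', hFn, mul_add]
    rintro v (rfl | hv)
    · rw [hnet, ha'u, net_eq_zero_of_notMem h.flow hu]
      simp [huv]
    · have hvu : v ≠ u := fun e => hu (e ▸ hv)
      rw [hnet, h.eqn v hv]
      by_cases hv0 : v = v₀
      · subst hv0
        have := h.root_ne
        simp only [a', hvu, if_false, if_true, Real.sq_sqrt hrad.le]
        simp only [Pi.single_apply, hvu, if_false, if_true]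
        field_simp
        ring
      · simp [a', hvu, hv0]
  · rintro v (rfl | hv)
    · exact ⟨F, hFmem, -c, by rw [hFn]; simp⟩
    · obtain ⟨θ, hθ, e, he⟩ := h.reach v hv
      exact ⟨θ, X.flows_mono hsub hθ, e, he⟩

/-- A proper nonempty vertex set is entered by some edge. -/
theorem exists_boundary_edge (X : LabeledGraph V W) {S : Set V} {v₀ : V} (h₀ : v₀ ∈ S)
    (hS : S ≠ Set.univ) : ∃ w, X.ini w ∉ S ∧ X.ter w ∈ S := by
  by_contra! hcon
  refine hS (Set.eq_univ_of_forall fun v => ?_)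
  induction X.connected v₀ v with
  | refl => exact h₀
  | tail _ hstep ih =>
    obtain ⟨w, rfl, rfl⟩ := hstep
    by_contra hn
    exact hcon (X.rev w) hn (by rwa [ter_rev])

theorem PartialSol.exists_npcSolution {X : LabeledGraph V W} {S : Set V} {v₀ : V} {a : V → ℝ}
    {x : W → ℝ} (h : X.PartialSol S v₀ a x) : ∃ a γ, X.NPCSolution a γ := by
  induction S using WellFoundedGT.induction generalizing a x with
  | ind S ih =>
  by_cases hS : S = Set.univ
  · subst hS
    have hpos : ∀ v, 0 < a v := fun v => h.pos v (Set.mem_univ v)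
    let γ : W → ℝ := fun w => x w * X.b w / (a (X.ini w) * a (X.ter w))
    have hsym : X.SymSol γ := by
      intro w
      simp only [γ, h.flow.1 w, X.b_symm, ini_rev, ter_rev, mul_comm (a (X.ter w))]
    have hlt : ∀ w, |γ w| < 1 := by
      intro w
      have hp := mul_pos (hpos (X.ini w)) (hpos (X.ter w))
      have := h.bound w ⟨Set.mem_univ _, Set.mem_univ _⟩
      rwa [abs_div, abs_of_pos hp, div_lt_one hp, abs_mul, abs_of_pos (X.b_cast_pos w)]
    refine ⟨a, γ, fun v => ?_, ⟨fun v => (hpos v).le, fun h0 => ?_, fun w => (hlt w).le,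
      fun w _ => hsym w, fun v hv => absurd hv (hpos v).ne'⟩, hsym, hpos, hlt⟩
    · have := h.eqn v (Set.mem_univ v)
      have hv := hpos v
      have e : X.k v * a v = X.net x v / a v := by rw [this]; field_simp
      rw [e, net_apply, Finset.sum_div]
      refine Finset.sum_congr rfl fun w hw => ?_
      obtain rfl := (Finset.mem_filter.mp hw).2
      have h1 := X.b_cast_pos w
      have h2 := hpos (X.ter w)
      simp only [γ]
      field_simp
    · exact (hpos v₀).ne' (congrFun h0 v₀)
  · obtain ⟨w, hw, hw'⟩ := X.exists_boundary_edge h.root_mem hS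
    obtain ⟨a', x', h'⟩ := h.extend hw hw'
    exact ih _ (Set.ssubset_insert hw) h'

theorem SameSign.trans {X : LabeledGraph V W} {u v w : V} (h : X.SameSign u v)
    (h' : X.SameSign v w) : X.SameSign u w :=
  Relation.ReflTransGen.trans h h'

theorem SameSign.mul_pos {X : LabeledGraph V W} {u v : V} (h : X.SameSign u v)
    (hu : X.k u ≠ 0) : 0 < X.k u * X.k v := by
  induction h with
  | refl => exact mul_self_pos.mpr hu
  | tail _ hstep ih =>
    have h2 := hstep.2
    rename_i b c _
    by_contra! hneg
    nlinarith [_root_.mul_pos ih h2, mul_nonneg (neg_nonneg.mpr hneg) (sq_nonneg (X.k b))]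

theorem sameSign_of_edge {X : LabeledGraph V W} {w : W}
    (h : 0 < X.k (X.ini w) * X.k (X.ter w)) : X.SameSign (X.ini w) (X.ter w) :=
  Relation.ReflTransGen.single ⟨⟨w, rfl, rfl⟩, h⟩

theorem SameSign.eq_of_zero {X : LabeledGraph V W} {u v : V} (h : X.SameSign u v)
    (hu : X.k u = 0) : u = v := by
  rcases Relation.ReflTransGen.cases_head h with h | ⟨c, ⟨_, hc⟩, _⟩
  · exact h
  · simp [hu] at hc

open scoped Classical in
/-- A nonnegative generalized eigenvector of the sign-component adjacency operator with
eigenvalue greater than one produces an NPC-solution. -/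
theorem exists_npcSolution_of_eigenvector (X : LabeledGraph V W) {μ : ℝ} (hμ : 1 < μ)
    {a : V → ℝ} (ha : ∀ v, 0 ≤ a v) {v₀ : V} (hk : X.k v₀ ≠ 0) (hv₀ : 0 < a v₀)
    (heq : ∀ v, μ * (|X.k v| * a v) = ∑ w ∈ univ.filter
      (fun w => X.ini w = v ∧ X.SameSign (X.ini w) (X.ter w)), a (X.ter w) / X.b w) :
    ∃ a γ, X.NPCSolution a γ := by
  let S : Set V := {v | X.SameSign v₀ v}
  have hμ0 : 0 < μ := by linarith
  have hpos : ∀ v ∈ S, 0 < a v := by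
    intro v hv
    change X.SameSign v₀ v at hv
    induction hv with
    | refl => exact hv₀
    | tail _ hstep ih =>
      obtain ⟨⟨w, rfl, rfl⟩, hkw⟩ := hstep
      refine lt_of_le_of_ne (ha _) fun h0 => ?_
      have hs := heq (X.ter w)
      rw [← h0, mul_zero, mul_zero, eq_comm, Finset.sum_eq_zero_iff_of_nonneg
        fun u _ => div_nonneg (ha _) (X.b_cast_pos u).le] at hs
      have := hs (X.rev w) (by
        simp only [mem_filter, mem_univ, true_and, ini_rev, ter_rev]
        exact (sameSign_of_edge hkw).symm)
      rw [ter_rev, div_eq_zero_iff] at this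
      rcases this with h | h
      · exact ih.ne' h
      · exact (X.b_cast_pos _).ne' h
  have hmem : ∀ w, X.ini w ∈ S → (X.ter w ∈ S ↔ X.SameSign (X.ini w) (X.ter w)) :=
    fun w hw => ⟨fun h => (SameSign.symm hw).trans h, fun h => SameSign.trans hw h⟩
  obtain ⟨σ, hσ, hσk⟩ : ∃ σ : ℝ, |σ| = 1 ∧ ∀ v ∈ S, σ * |X.k v| = X.k v := by
    rcases lt_or_gt_of_ne hk with h | h
    · refine ⟨-1, by simp, fun v hv => ?_⟩
      have : X.k v < 0 := by
        have := SameSign.mul_pos hv hk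
        by_contra! h'
        nlinarith
      rw [abs_of_neg this]
      ring
    · refine ⟨1, by simp, fun v hv => ?_⟩
      have : 0 < X.k v := by
        have := SameSign.mul_pos hv hk
        by_contra! h'
        nlinarith
      rw [abs_of_pos this, one_mul]
  let x : W → ℝ := fun w => if w ∈ X.inner S then
    σ / μ * (a (X.ini w) * a (X.ter w) / X.b w) else 0
  have hrev : ∀ w ∈ X.inner S, X.rev w ∈ X.inner S := fun w hw =>
    ⟨hw.2, by rw [ter_rev]; exact hw.1⟩
  refine PartialSol.exists_npcSolution (S := S) (v₀ := v₀) (a := a) (x := x)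
    ⟨hpos, ⟨fun w => ?_, fun w hw => by simp [x, hw]⟩, fun w hw => ?_, fun v hv => ?_,
      Relation.ReflTransGen.refl, hk, fun p hp => ?_⟩
  · have : X.rev w ∈ X.inner S ↔ w ∈ X.inner S :=
      ⟨fun h => by simpa [X.rev_invol] using hrev _ h, hrev w⟩
    simp only [x, this, ini_rev, ter_rev, X.b_symm, mul_comm (a (X.ter w))]
  · have hp := mul_pos (hpos _ hw.1) (hpos _ hw.2)
    have hb := X.b_cast_pos w
    simp only [x, hw, if_true]
    rw [abs_mul, abs_div, hσ, abs_of_pos hμ0, abs_of_pos (div_pos hp hb)]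
    have e : 1 / μ * (a (X.ini w) * a (X.ter w) / X.b w) * X.b w =
        a (X.ini w) * a (X.ter w) / μ := by field_simp
    rw [e]
    exact div_lt_self hp hμ
  · have e : X.net x v = σ / μ * a v * ∑ w ∈ univ.filter
        (fun w => X.ini w = v ∧ X.SameSign (X.ini w) (X.ter w)), a (X.ter w) / X.b w := by
      rw [net_apply, ← Finset.filter_filter, Finset.mul_sum]
      conv_rhs => rw [Finset.sum_filter]
      refine Finset.sum_congr rfl fun w hw => ?_
      obtain rfl := (Finset.mem_filter.mp hw).2
      have : w ∈ X.inner S ↔ X.SameSign (X.ini w) (X.ter w) :=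
        ⟨fun h => (hmem w hv).mp h.2, fun h => ⟨hv, (hmem w hv).mpr h⟩⟩
      simp only [x, this]
      split_ifs
      · ring
      · rfl
    rw [e, ← heq]
    conv_rhs => rw [← hσk v hv]
    field_simp
  · refine (X.exists_flow_path hrev (q := v₀) (p := p) ?_).imp fun φ h => ⟨h.1, h.2.imp
      fun c hc => hc.2⟩
    change X.SameSign v₀ p at hp
    induction hp with
    | refl => exact Relation.ReflTransGen.refl
    | tail hab hstep ih =>
      obtain ⟨⟨w, rfl, rfl⟩, hkw⟩ := hstep
      exact ih.tail ⟨w, ⟨hab, hab.tail ⟨⟨w, rfl, rfl⟩, hkw⟩⟩, rfl, rfl⟩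

/-- The vertices reachable from `q` through vertices of charge zero. -/
def zeroComp (X : LabeledGraph V W) (q : V) : Set V :=
  {v | Relation.ReflTransGen
    (fun x y => (∃ w, X.ini w = x ∧ X.ter w = y) ∧ X.k x = 0 ∧ X.k y = 0) q v}

theorem mem_zeroComp_self (X : LabeledGraph V W) (q : V) : q ∈ X.zeroComp q :=
  Relation.ReflTransGen.refl

theorem k_eq_zero_of_mem_zeroComp {X : LabeledGraph V W} {q v : V} (hq : X.k q = 0)
    (hv : v ∈ X.zeroComp q) : X.k v = 0 := by
  rcases Relation.ReflTransGen.cases_tail hv with h | ⟨c, _, _, _, h⟩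
  · rwa [h]
  · exact h

theorem ter_mem_zeroComp {X : LabeledGraph V W} {q : V} (hq : X.k q = 0) {w : W}
    (hw : X.ini w ∈ X.zeroComp q) (hk : X.k (X.ter w) = 0) : X.ter w ∈ X.zeroComp q :=
  Relation.ReflTransGen.tail hw ⟨⟨w, rfl, rfl⟩, k_eq_zero_of_mem_zeroComp hq hw, hk⟩

theorem zeroComp_eq {X : LabeledGraph V W} {w : W} (h : X.k (X.ini w) = 0)
    (h' : X.k (X.ter w) = 0) : X.zeroComp (X.ini w) = X.zeroComp (X.ter w) := by
  ext v
  constructor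
  · exact fun hv => Relation.ReflTransGen.head
      ⟨⟨X.rev w, X.ini_rev w, X.ter_rev w⟩, h', h⟩ hv
  · exact fun hv => Relation.ReflTransGen.head ⟨⟨w, rfl, rfl⟩, h, h'⟩ hv

open Filter Topology in
/-- If the charges around a component of zero-charge vertices can be balanced by a flow on the
edges touching it, then there is an NPC-solution. -/
theorem exists_npcSolution_of_zeroComp_flow (X : LabeledGraph V W) {Q S : Set V} {M : Set W}
    (hQ : ∀ v ∈ Q, X.k v = 0) (hM : M = {w | X.ini w ∈ Q ∨ X.ter w ∈ Q})
    (hMS : M ⊆ X.inner S)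
    {F : W → ℝ} (hF : F ∈ X.flows M) {α : V → ℝ} (hα : ∀ v, 0 < α v)
    (hnet : ∀ v ∈ S, X.net F v = X.k v * α v) {v₀ : V} (hv₀ : v₀ ∈ S) (hk : X.k v₀ ≠ 0)
    (hreach : ∀ p ∈ S, ∃ φ ∈ X.flows M, ∃ c : ℝ,
      X.net φ = Pi.single p 1 - c • Pi.single v₀ 1) :
    ∃ a γ, X.NPCSolution a γ := by
  classical
  let a : ℝ → V → ℝ := fun δ v => if v ∈ Q then 1 else δ * √(α v)
  have hs : ∀ v, 0 < √(α v) := fun v => Real.sqrt_pos.mpr (hα v)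
  have ev_delta : ∀ᶠ δ : ℝ in 𝓝[>] 0, 0 < δ := self_mem_nhdsWithin
  have ev_one : ∀ᶠ δ in 𝓝[>] (0 : ℝ), ∀ w, δ ^ 2 * |F w| * X.b w < 1 :=
    eventually_all.mpr fun w => by
      have : Continuous fun δ : ℝ => δ ^ 2 * |F w| * X.b w := by fun_prop
      exact ((this.tendsto 0).mono_left nhdsWithin_le_nhds).eventually_lt_const (by simp)
  have ev_sqrt : ∀ᶠ δ in 𝓝[>] (0 : ℝ), ∀ w v, δ * |F w| * X.b w < √(α v) :=
    eventually_all.mpr fun w => eventually_all.mpr fun v => by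
      have : Continuous fun δ : ℝ => δ * |F w| * X.b w := by fun_prop
      exact ((this.tendsto 0).mono_left nhdsWithin_le_nhds).eventually_lt_const (by simp [hs v])
  obtain ⟨δ, hδ, hone, hsqrt⟩ := (ev_delta.and (ev_one.and ev_sqrt)).exists
  have habs (w : W) : |(δ ^ 2 • F) w| = δ ^ 2 * |F w| := by simp [abs_mul]
  have hside (w : W) (v : V) : δ ^ 2 * |F w| * X.b w < δ * √(α v) := by
    have := mul_lt_mul_of_pos_left (hsqrt w v) hδ
    linarith
  have hpos : ∀ v, 0 < a δ v := by
    intro v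
    by_cases hv : v ∈ Q
    · simp [a, hv]
    · simpa [a, hv] using mul_pos hδ (hs v)
  refine PartialSol.exists_npcSolution (S := S) (v₀ := v₀) (a := a δ) (x := δ ^ 2 • F)
    ⟨fun v _ => hpos v, X.flows_mono hMS (Submodule.smul_mem _ _ hF), fun w _ => ?_,
      fun v hv => ?_, hv₀, hk, fun p hp => ?_⟩
  · rw [habs]
    by_cases h1 : X.ini w ∈ Q <;> by_cases h2 : X.ter w ∈ Q
    · simpa [a, h1, h2] using hone w
    · simpa [a, h1, h2] using hside w _
    · simpa [a, h1, h2] using hside w _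
    · have : F w = 0 := hF.2 w (by simp [hM, h1, h2])
      rw [this]
      simpa using mul_pos (hpos (X.ini w)) (hpos (X.ter w))
  · rw [map_smul, Pi.smul_apply, smul_eq_mul, hnet v hv]
    by_cases h : v ∈ Q
    · simp [hQ v h]
    · simp only [a, h, if_false, mul_pow, Real.sq_sqrt (hα v).le]
      ring
  · exact (hreach p hp).imp fun φ h => ⟨X.flows_mono hMS h.1, h.2⟩

open scoped Classical in
/-- Around a component of zero-charge vertices, either an NPC-solution can be built or the signs
of the neighbouring charges extend to an alternating function on the component. -/
theorem exists_npcSolution_or_alternating (X : LabeledGraph V W) (hne : ∃ v, X.k v ≠ 0)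
    {q : V} (hq : X.k q = 0) :
    (∃ a γ, X.NPCSolution a γ) ∨
      ∃ y : V → ℝ, (∀ v, y v = 1 ∨ y v = -1) ∧
        ∀ w, X.ini w ∈ X.zeroComp q → y (X.ter w) = -y (X.ini w) ∧
          (X.k (X.ter w) ≠ 0 → 0 < y (X.ter w) * X.k (X.ter w)) := by
  set Q := X.zeroComp q with hQdef
  have hQ : ∀ v ∈ Q, X.k v = 0 := fun v hv => k_eq_zero_of_mem_zeroComp hq hv
  let M : Set W := {w | X.ini w ∈ Q ∨ X.ter w ∈ Q}
  let S : Set V := {v | v ∈ Q ∨ ∃ w, X.ini w ∈ Q ∧ X.ter w = v}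
  have hrev : ∀ w ∈ M, X.rev w ∈ M := by
    rintro w (h | h)
    · exact Or.inr (by rwa [ter_rev])
    · exact Or.inl h
  have hMS : M ⊆ X.inner S := by
    rintro w (h | h)
    · exact ⟨Or.inl h, Or.inr ⟨w, h, rfl⟩⟩
    · exact ⟨Or.inr ⟨X.rev w, h, X.ter_rev w⟩, Or.inl h⟩
  have hSQ : ∀ v ∈ S, X.k v = 0 → v ∈ Q := by
    rintro v (h | ⟨w, h, rfl⟩) hk
    · exact h
    · exact ter_mem_zeroComp hq h hk
  have hpath : ∀ p ∈ S, Relation.ReflTransGen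
      (fun x y => ∃ w ∈ M, X.ini w = x ∧ X.ter w = y) q p := by
    have hp : ∀ p ∈ Q, Relation.ReflTransGen
        (fun x y => ∃ w ∈ M, X.ini w = x ∧ X.ter w = y) q p := by
      intro p hp
      change Relation.ReflTransGen _ q p at hp
      induction hp with
      | refl => exact Relation.ReflTransGen.refl
      | tail hab hstep ih =>
        obtain ⟨⟨w, rfl, rfl⟩, _⟩ := hstep
        exact ih.tail ⟨w, Or.inl hab, rfl, rfl⟩
    rintro p (h | ⟨w, h, rfl⟩)
    · exact hp p h
    · exact (hp _ h).tail ⟨w, Or.inl h, rfl, rfl⟩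
  have hflow : ∀ p, ∃ φ ∈ X.flows M, ∃ c : ℝ, (c = 1 ∨ c = -1) ∧
      (p ∈ S → X.net φ = Pi.single p 1 - c • Pi.single q 1) := by
    intro p
    by_cases hp : p ∈ S
    · obtain ⟨φ, hφ, c, hc, h⟩ := X.exists_flow_path hrev (hpath p hp)
      exact ⟨φ, hφ, c, hc, fun _ => h⟩
    · exact ⟨0, Submodule.zero_mem _, 1, Or.inl rfl, fun h => absurd h hp⟩
  choose φ hφ c hc hφn using hflow
  have hqQ : q ∈ Q := X.mem_zeroComp_self q
  obtain ⟨v₀, hv₀, hk₀⟩ : ∃ v ∈ S, X.k v ≠ 0 := by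
    obtain ⟨v, hv⟩ := hne
    have hQu : Q ≠ Set.univ := fun h => hv (hQ v (h ▸ Set.mem_univ v))
    obtain ⟨w, hw, hw'⟩ := X.exists_boundary_edge hqQ hQu
    have hwS : X.ini w ∈ S := (hMS (Or.inr hw')).1
    exact ⟨_, hwS, fun h => hw (hSQ _ hwS h)⟩
  have hreach : ∀ p ∈ S, ∃ θ ∈ X.flows M, ∃ e : ℝ,
      X.net θ = Pi.single p 1 - e • Pi.single v₀ 1 := by
    intro p hp
    refine ⟨φ p - (c p * c v₀) • φ v₀,
      Submodule.sub_mem _ (hφ p) (Submodule.smul_mem _ _ (hφ v₀)), c p * c v₀, ?_⟩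
    have h1 : c p * c v₀ * c v₀ = c p := by rcases hc v₀ with h | h <;> simp [h]
    rw [map_sub, map_smul, hφn p hp, hφn v₀ hv₀, smul_sub, smul_smul, h1]
    abel
  let N : Finset V := univ.filter fun v => v ∈ S
  have hG (α : V → ℝ) : X.net (∑ v ∈ N, (X.k v * α v) • φ v) =
      (∑ v ∈ N, (X.k v * α v) • Pi.single v 1) -
        (∑ v ∈ N, X.k v * c v * α v) • Pi.single q 1 := by
    rw [map_sum, Finset.sum_smul, ← Finset.sum_sub_distrib]
    refine Finset.sum_congr rfl fun v hv => ?_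
    rw [map_smul, hφn v (Finset.mem_filter.mp hv).2, smul_sub, smul_smul]
    congr 2
    ring
  have hGmem (α : V → ℝ) : ∑ v ∈ N, (X.k v * α v) • φ v ∈ X.flows M :=
    Submodule.sum_mem _ fun v _ => Submodule.smul_mem _ _ (hφ v)
  have hsum (α : V → ℝ) : ∀ u ∈ S,
      (∑ v ∈ N, (X.k v * α v) • (Pi.single v 1 : V → ℝ)) u = X.k u * α u := by
    intro u hu
    simp only [Finset.sum_apply, Pi.smul_apply, smul_eq_mul, Pi.single_apply, mul_ite, mul_one,
      mul_zero]
    rw [Finset.sum_ite_eq]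
    simp [N, hu]
  by_cases hroot : ∃ ε ∈ X.flows M, X.net ε = Pi.single q 1
  · left
    obtain ⟨ε, hε, hεn⟩ := hroot
    refine X.exists_npcSolution_of_zeroComp_flow (Q := Q) (S := S) (M := M) hQ rfl hMS
      (Submodule.add_mem _ (hGmem fun _ => 1)
        (Submodule.smul_mem _ (∑ v ∈ N, X.k v * c v * 1) hε)) (α := fun _ => 1)
      (fun _ => one_pos) (fun v hv => ?_) hv₀ hk₀ hreach
    rw [map_add, map_smul, hG, hεn, sub_add_cancel, hsum _ v hv]
  have halt : ∀ w ∈ M, c (X.ini w) + c (X.ter w) = 0 := by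
    intro w hw
    by_contra hcw
    obtain ⟨ψ, hψ, hψn⟩ := X.exists_flow_edge hw (hrev w hw)
    refine hroot ⟨(c (X.ini w) + c (X.ter w))⁻¹ • (ψ - φ (X.ini w) - φ (X.ter w)),
      Submodule.smul_mem _ _ (Submodule.sub_mem _ (Submodule.sub_mem _ hψ (hφ _)) (hφ _)), ?_⟩
    have e : X.net (ψ - φ (X.ini w) - φ (X.ter w)) =
        (c (X.ini w) + c (X.ter w)) • Pi.single q 1 := by
      rw [map_sub, map_sub, hψn, hφn _ (hMS hw).1, hφn _ (hMS hw).2, add_smul]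
      abel
    rw [map_smul, e, smul_smul, inv_mul_cancel₀ hcw, one_smul]
  have hc0 : ∀ v, c v ≠ 0 := fun v => by rcases hc v with h | h <;> simp [h]
  by_cases hmix : ∃ u ∈ N, ∃ v ∈ N, 0 < X.k u * c u ∧ X.k v * c v < 0
  · left
    obtain ⟨u, hu, v, hv, h1, h2⟩ := hmix
    obtain ⟨α, hα, hα0⟩ :=
      exists_pos_weights_sum_eq_zero (f := fun v => X.k v * c v) hu hv h1 h2
    refine X.exists_npcSolution_of_zeroComp_flow (Q := Q) (S := S) (M := M) hQ rfl hMS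
      (hGmem α) hα (fun v hv => ?_) hv₀ hk₀ hreach
    rw [hG, hα0, zero_smul, sub_zero, hsum _ v hv]
  right
  push Not at hmix
  have hNmem : ∀ w, X.ini w ∈ Q → X.ter w ∈ N := fun w hw =>
    Finset.mem_filter.mpr ⟨Finset.mem_univ _, (hMS (Or.inl hw)).2⟩
  by_cases hp : ∃ u ∈ N, 0 < X.k u * c u
  · obtain ⟨u, hu, hpu⟩ := hp
    refine ⟨c, hc, fun w hw => ⟨by linarith [halt w (Or.inl hw)], fun hk => ?_⟩⟩
    have := hmix u hu _ (hNmem w hw) hpu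
    rw [mul_comm]
    exact lt_of_le_of_ne this (mul_ne_zero hk (hc0 _)).symm
  · push Not at hp
    refine ⟨fun v => -c v, fun v => ?_, fun w hw => ⟨?_, fun hk => ?_⟩⟩
    · rcases hc v with h | h <;> simp [h]
    · linarith [halt w (Or.inl hw)]
    · have h1 := lt_of_le_of_ne (hp _ (hNmem w hw)) (mul_ne_zero hk (hc0 _))
      linarith

/-- A sign function agreeing with the nonzero charges and alternating along every edge that
starts at a zero-charge vertex. -/
structure Balanced (X : LabeledGraph V W) (t : V → ℝ) : Prop where
  sign : ∀ v, t v = 1 ∨ t v = -1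
  pos : ∀ v, X.k v ≠ 0 → 0 < t v * X.k v
  alt : ∀ w, X.k (X.ini w) = 0 → t (X.ter w) = -t (X.ini w)

theorem exists_npcSolution_of_charges_zero (X : LabeledGraph V W) (hk : ∀ v, X.k v = 0) :
    ∃ a γ, X.NPCSolution a γ := by
  obtain ⟨w⟩ := X.edges_nonempty
  refine ⟨fun _ => 1, fun _ => 0, fun v => by simp [hk], ⟨fun _ => zero_le_one, fun h => ?_,
    fun w => by simp, fun w _ => rfl, fun v h => by simp at h⟩, fun w => rfl,
    fun _ => one_pos, fun w => by simp⟩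
  simpa using congrFun h (X.ini w)

open scoped Classical in
theorem exists_npcSolution_or_balanced (X : LabeledGraph V W) :
    (∃ a γ, X.NPCSolution a γ) ∨ ∃ t, X.Balanced t := by
  by_cases hne : ∃ v, X.k v ≠ 0
  swap
  · push Not at hne
    exact Or.inl (X.exists_npcSolution_of_charges_zero hne)
  by_cases hnpc : ∃ a γ, X.NPCSolution a γ
  · exact Or.inl hnpc
  right
  have hy : ∀ A : Set V, ∃ y : V → ℝ, (∀ v, y v = 1 ∨ y v = -1) ∧
      ((∃ q, X.k q = 0 ∧ X.zeroComp q = A) → ∀ w, X.ini w ∈ A →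
        y (X.ter w) = -y (X.ini w) ∧
          (X.k (X.ter w) ≠ 0 → 0 < y (X.ter w) * X.k (X.ter w))) := by
    intro A
    by_cases h : ∃ q, X.k q = 0 ∧ X.zeroComp q = A
    · obtain ⟨q, hq, rfl⟩ := h
      obtain ⟨y, h1, h2⟩ := (X.exists_npcSolution_or_alternating hne hq).resolve_left hnpc
      exact ⟨y, h1, fun _ => h2⟩
    · exact ⟨fun _ => 1, fun _ => Or.inl rfl, fun h' => absurd h' h⟩
  choose y hy1 hy2 using hy
  refine ⟨fun v => if X.k v = 0 then y (X.zeroComp v) v else if 0 < X.k v then 1 else -1,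
    fun v => ?_, fun v hv => ?_, fun w hw => ?_⟩
  · split_ifs
    · exact hy1 _ v
    · exact Or.inl rfl
    · exact Or.inr rfl
  · simp only [hv, if_false]
    split_ifs with h
    · simpa using h
    · have := lt_of_le_of_ne (not_lt.mp h) hv
      linarith
  · obtain ⟨h1, h2⟩ := hy2 _ ⟨_, hw, rfl⟩ w (X.mem_zeroComp_self _)
    simp only [hw, if_true]
    by_cases hw' : X.k (X.ter w) = 0
    · simp only [hw', if_true]
      rw [← zeroComp_eq hw hw', h1]
    · rw [← h1]
      have h3 := h2 hw'
      simp only [hw', if_false]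
      rcases hy1 (X.zeroComp (X.ini w)) (X.ter w) with h | h <;> rw [h] at h3 ⊢
      · rw [if_pos (by linarith)]
      · rw [if_neg (by linarith)]

theorem Balanced.eq_of_mul_pos {X : LabeledGraph V W} {t : V → ℝ} (ht : X.Balanced t) {u v : V}
    (h : 0 < X.k u * X.k v) : t u = t v := by
  have hu := ht.pos u (left_ne_zero_of_mul h.ne')
  have hv := ht.pos v (right_ne_zero_of_mul h.ne')
  rcases ht.sign u with h1 | h1 <;> rcases ht.sign v with h2 | h2 <;>
    rw [h1] at hu <;> rw [h2] at hv <;> first | (rw [h1, h2]; done) | nlinarith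

theorem Balanced.eq_of_sameSign {X : LabeledGraph V W} {t : V → ℝ} (ht : X.Balanced t) {u v : V}
    (h : X.SameSign u v) : t u = t v := by
  by_cases hu : X.k u = 0
  · rw [h.eq_of_zero hu]
  · exact ht.eq_of_mul_pos (h.mul_pos hu)

theorem Balanced.neg_of_not_sameSign {X : LabeledGraph V W} {t : V → ℝ} (ht : X.Balanced t)
    {w : W} (h : ¬X.SameSign (X.ini w) (X.ter w)) : t (X.ini w) = -t (X.ter w) := by
  by_cases hu : X.k (X.ini w) = 0
  · rw [ht.alt w hu, neg_neg]
  by_cases hv : X.k (X.ter w) = 0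
  · have := ht.alt (X.rev w) (by rwa [ini_rev])
    rwa [ter_rev, ini_rev] at this
  have hneg : X.k (X.ini w) * X.k (X.ter w) < 0 :=
    lt_of_le_of_ne (not_lt.mp fun h' => h (sameSign_of_edge h')) (mul_ne_zero hu hv)
  have h1 := ht.pos _ hu
  have h2 := ht.pos _ hv
  rcases ht.sign (X.ini w) with e1 | e1 <;> rcases ht.sign (X.ter w) with e2 | e2 <;>
    rw [e1] at h1 <;> rw [e2] at h2 <;> rw [e1, e2] <;> first | (norm_num; done) | nlinarith

theorem Balanced.typeII {X : LabeledGraph V W} {t : V → ℝ} (ht : X.Balanced t)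
    (hk : ∃ v, 0 < X.k v) : X.TypeII t := by
  refine ⟨ht.sign, fun u v h => ht.eq_of_sameSign h, fun w h => ht.neg_of_not_sameSign h, ?_⟩
  obtain ⟨v, hv⟩ := hk
  refine ⟨v, ?_, hv⟩
  have := ht.pos v hv.ne'
  rcases ht.sign v with h | h
  · exact h
  · rw [h] at this
    linarith

theorem TypeII.eq_of_balanced {X : LabeledGraph V W} {s t : V → ℝ} (hs : X.TypeII s)
    (ht : X.Balanced t) : s = t := by
  obtain ⟨hs1, hs2, hs3, v, hv, hkv⟩ := hs
  have hcv : s v * t v = 1 := by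
    have := ht.pos v hkv.ne'
    rcases ht.sign v with h | h
    · simp [hv, h]
    · rw [h] at this
      linarith
  ext u
  have hcu : s u * t u = 1 := by
    induction X.connected v u with
    | refl => exact hcv
    | tail _ hstep ih =>
      obtain ⟨w, rfl, rfl⟩ := hstep
      rw [ini_rev]
      by_cases h : X.SameSign (X.ini w) (X.ter w)
      · rwa [← hs2 _ _ h, ← ht.eq_of_sameSign h]
      · rw [hs3 w h, ht.neg_of_not_sameSign h] at ih
        linarith
  rcases ht.sign u with h | h <;> rw [h] at hcu ⊢ <;> linarith

open scoped Classical in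
/-- The weighted adjacency operator of the edges inside sign components. -/
noncomputable def sameSignAdj (X : LabeledGraph V W) : Matrix V V ℝ :=
  Matrix.of fun v v' => ∑ w ∈ univ.filter
    (fun w => X.ini w = v ∧ X.ter w = v' ∧ X.SameSign (X.ini w) (X.ter w)), (1 : ℝ) / (X.b w)

theorem Hop_eq (X : LabeledGraph V W) (s : V → ℝ) :
    X.Hop s = Matrix.diagonal (fun v => s v * X.k v) - X.sameSignAdj := by
  ext v v'
  simp [Hop, sameSignAdj, Matrix.diagonal_apply]

theorem sameSignAdj_nonneg (X : LabeledGraph V W) (v v' : V) : 0 ≤ X.sameSignAdj v v' := by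
  classical
  exact Finset.sum_nonneg fun w _ => by positivity

theorem isSymm_sameSignAdj (X : LabeledGraph V W) : X.sameSignAdj.IsSymm := by
  classical
  ext v v'
  simp only [Matrix.transpose_apply, sameSignAdj, Matrix.of_apply]
  refine Finset.sum_nbij' X.rev X.rev ?_ ?_ (fun w _ => X.rev_invol w) (fun w _ => X.rev_invol w)
    (fun w _ => by rw [X.b_symm])
  all_goals
    intro w hw
    simp only [mem_filter, mem_univ, true_and, ini_rev, ter_rev] at hw ⊢
    exact ⟨hw.2.1, hw.1, hw.2.2.symm⟩

open scoped Classical in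
theorem sameSignAdj_mulVec (X : LabeledGraph V W) (x : V → ℝ) (v : V) :
    (X.sameSignAdj *ᵥ x) v = ∑ w ∈ univ.filter
      (fun w => X.ini w = v ∧ X.SameSign (X.ini w) (X.ter w)), x (X.ter w) / X.b w := by
  simp only [mulVec, dotProduct, sameSignAdj, Matrix.of_apply, Finset.sum_mul, Finset.sum_filter]
  rw [Finset.sum_comm]
  refine Finset.sum_congr rfl fun w _ => ?_
  rw [Finset.sum_eq_single (X.ter w)]
  · by_cases h1 : X.ini w = v <;> by_cases h2 : X.SameSign (X.ini w) (X.ter w) <;>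
      simp [h1, h2, div_eq_inv_mul]
  · intro u _ hu
    simp [hu.symm]
  · simp

theorem dotProduct_Hop_mulVec (X : LabeledGraph V W) (s x : V → ℝ) :
    x ⬝ᵥ X.Hop s *ᵥ x = ∑ v, s v * X.k v * x v ^ 2 - x ⬝ᵥ X.sameSignAdj *ᵥ x := by
  rw [Hop_eq, Matrix.sub_mulVec, dotProduct_sub]
  congr 1
  simp only [dotProduct, Matrix.mulVec_diagonal]
  exact Finset.sum_congr rfl fun v _ => by ring

open scoped Classical in
theorem dotProduct_sameSignAdj_mulVec (X : LabeledGraph V W) (x : V → ℝ) :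
    x ⬝ᵥ X.sameSignAdj *ᵥ x = ∑ w ∈ univ.filter (fun w => X.SameSign (X.ini w) (X.ter w)),
      x (X.ini w) * x (X.ter w) / X.b w := by
  simp only [dotProduct, sameSignAdj_mulVec, Finset.mul_sum]
  rw [← Finset.sum_fiberwise (univ.filter fun w => X.SameSign (X.ini w) (X.ter w)) X.ini]
  refine Finset.sum_congr rfl fun v _ => ?_
  rw [Finset.filter_filter]
  refine Finset.sum_congr ?_ fun w hw => ?_
  · ext w
    simp [and_comm]
  · rw [← (Finset.mem_filter.mp hw).2.2]
    ring

theorem exists_npcSolution_of_hasNegEigenvalue (X : LabeledGraph V W) {s : V → ℝ}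
    (hs : X.TypeII s) (hneg : HasNegEigenvalue (X.Hop s)) : ∃ a γ, X.NPCSolution a γ := by
  rcases X.exists_npcSolution_or_balanced with h | ⟨t, ht⟩
  · exact h
  obtain rfl := hs.eq_of_balanced ht
  classical
  obtain ⟨x, hx⟩ := dotProduct_neg_of_hasNegEigenvalue hneg
  have habs : ∀ v, s v * X.k v = |X.k v| := by
    intro v
    by_cases hv : X.k v = 0
    · simp [hv]
    · have h1 := ht.pos v hv
      rw [← abs_of_pos h1, abs_mul]
      rcases ht.sign v with h | h <;> simp [h]
  rw [dotProduct_Hop_mulVec, sub_neg] at hx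
  simp only [habs] at hx
  have hz : ∀ v v', |X.k v| = 0 → X.sameSignAdj v v' = 0 := by
    intro v v' hv
    refine Finset.sum_eq_zero fun w hw => ?_
    obtain ⟨rfl, _, h⟩ := (Finset.mem_filter.mp hw).2
    have h0 := abs_eq_zero.mp hv
    have h1 := ht.alt w h0
    rw [← h.eq_of_zero h0] at h1
    rcases ht.sign (X.ini w) with h | h <;> rw [h] at h1 <;> norm_num at h1
  obtain ⟨μ, hμ, a, ha, ⟨v₀, hk, hv₀⟩, heq⟩ := exists_nonneg_generalized_eigenvector
    (fun v => abs_nonneg (X.k v)) X.sameSignAdj_nonneg X.isSymm_sameSignAdj hz hx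
  exact X.exists_npcSolution_of_eigenvector hμ ha (abs_pos.mp hk) hv₀
    fun v => by rw [heq, sameSignAdj_mulVec]

theorem NPCSolution.hasNegEigenvalue {X : LabeledGraph V W} {a : V → ℝ} {γ : W → ℝ}
    (h : X.NPCSolution a γ) {s : V → ℝ} (hs : X.TypeII s) : HasNegEigenvalue (X.Hop s) := by
  classical
  obtain ⟨hbkn, -, hsym, hpos, hlt⟩ := h
  have hHsymm : (X.Hop s).IsSymm := by
    rw [Hop_eq]
    exact (Matrix.isSymm_diagonal _).sub X.isSymm_sameSignAdj
  let x : W → ℝ := fun w => γ w / X.b w * (a (X.ini w) * a (X.ter w))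
  have hxrev : ∀ w, x (X.rev w) = x w := fun w => by
    simp only [x, hsym w, X.b_symm, ini_rev, ter_rev, mul_comm (a (X.ter w))]
  have hcharge : ∑ v, s v * X.k v * a v ^ 2 = ∑ w, s (X.ini w) * x w := by
    rw [← Finset.sum_fiberwise univ X.ini]
    refine Finset.sum_congr rfl fun v _ => ?_
    have e : s v * X.k v * a v ^ 2 = s v * a v * (X.k v * a v) := by ring
    rw [e, hbkn v, Finset.mul_sum]
    refine Finset.sum_congr rfl fun w hw => ?_
    rw [← (Finset.mem_filter.mp hw).2]
    simp only [x]
    ring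
  have hswap : ∑ w, s (X.ini w) * x w = ∑ w, s (X.ter w) * x w := by
    refine Finset.sum_nbij' X.rev X.rev (by simp) (by simp) (fun w _ => X.rev_invol w)
      (fun w _ => X.rev_invol w) fun w _ => ?_
    rw [hxrev, ter_rev]
  have hsame : ∑ w, s (X.ini w) * x w =
      ∑ w ∈ univ.filter (fun w => X.SameSign (X.ini w) (X.ter w)), s (X.ini w) * x w := by
    have h2 : ∑ w, s (X.ini w) * x w = ∑ w, (s (X.ini w) + s (X.ter w)) / 2 * x w := by
      have e : ∀ w, (s (X.ini w) + s (X.ter w)) / 2 * x w =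
          (s (X.ini w) * x w + s (X.ter w) * x w) / 2 := fun w => by ring
      simp only [e]
      rw [← Finset.sum_div, Finset.sum_add_distrib, ← hswap]
      ring
    rw [h2, Finset.sum_filter]
    refine Finset.sum_congr rfl fun w _ => ?_
    split_ifs with hw
    · rw [← hs.2.1 _ _ hw]
      ring
    · rw [hs.2.2.1 w hw]
      ring
  have hterm : ∀ w, s (X.ini w) * x w < a (X.ini w) * a (X.ter w) / X.b w := by
    intro w
    have hp := div_pos (mul_pos (hpos (X.ini w)) (hpos (X.ter w))) (X.b_cast_pos w)
    have hγ := abs_lt.mp (hlt w)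
    have e : s (X.ini w) * x w =
        s (X.ini w) * γ w * (a (X.ini w) * a (X.ter w) / X.b w) := by
      simp only [x]
      ring
    rw [e]
    refine mul_lt_of_lt_one_left hp ?_
    rcases hs.1 (X.ini w) with h | h <;> rw [h] <;> linarith
  by_cases hex : ∃ w, X.SameSign (X.ini w) (X.ter w)
  · refine hasNegEigenvalue_of_dotProduct_neg hHsymm (x := a) ?_
    rw [dotProduct_Hop_mulVec, sub_neg, hcharge, hsame, dotProduct_sameSignAdj_mulVec]
    obtain ⟨w, hw⟩ := hex
    exact Finset.sum_lt_sum_of_nonempty ⟨w, by simp [hw]⟩ fun w _ => hterm w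
  · have hzero : ∑ v, s v * X.k v * a v ^ 2 = 0 := by
      rw [hcharge, hsame]
      exact Finset.sum_eq_zero fun w hw => absurd ⟨w, (Finset.mem_filter.mp hw).2⟩ hex
    obtain ⟨v, hv, hkv⟩ := hs.2.2.2
    obtain ⟨u, hu⟩ : ∃ u, s u * X.k u < 0 := by
      by_contra! hcon
      have := (Finset.sum_eq_zero_iff_of_nonneg
        fun u _ => mul_nonneg (hcon u) (sq_nonneg (a u))).mp hzero v (Finset.mem_univ v)
      rw [hv, one_mul] at this
      exact (mul_pos hkv (pow_pos (hpos v) 2)).ne' this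
    refine hasNegEigenvalue_of_dotProduct_neg hHsymm (x := Pi.single u 1) ?_
    rw [dotProduct_Hop_mulVec, sub_neg, dotProduct_sameSignAdj_mulVec]
    rw [Finset.sum_eq_zero fun w hw => absurd ⟨w, (Finset.mem_filter.mp hw).2⟩ hex,
      Finset.sum_eq_single u (fun v _ hvu => by simp [hvu]) (by simp)]
    simpa using hu

end LabeledGraph

open LabeledGraph in
/-- Spectral criterion for (NPC): the BKN-equation over `X` (with all charges zero or at
least one positive charge) has an NPC-solution iff the operator `H` has a negative real
eigenvalue or the admissible sign function `s` is identically zero. -/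
theorem npc_solution_iff_spectral
    {V W : Type} [Fintype V] [DecidableEq V] [Fintype W] [DecidableEq W]
    (X : LabeledGraph V W)
    (hcharges : (∀ v, X.k v = 0) ∨ (∃ v, 0 < X.k v))
    (s : V → ℝ) (hs : X.Admissible s) :
    (∃ (a : V → ℝ) (γ : W → ℝ), X.NPCSolution a γ) ↔
      (HasNegEigenvalue (X.Hop s) ∨ s = 0) := by
  rcases hs with hs | ⟨hs, hno⟩
  · constructor
    · rintro ⟨a, γ, h⟩
      exact Or.inl (h.hasNegEigenvalue hs)
    · rintro (h | h)
      · exact X.exists_npcSolution_of_hasNegEigenvalue hs h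
      · obtain ⟨v, hv, _⟩ := hs.2.2.2
        simp [h] at hv
  · refine ⟨fun _ => Or.inr hs, fun _ => ?_⟩
    rcases hcharges with h0 | hpos
    · exact X.exists_npcSolution_of_charges_zero h0
    · refine X.exists_npcSolution_or_balanced.resolve_right fun ⟨t, ht⟩ => ?_
      exact hno ⟨t, ht.typeII hpos⟩
end
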